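/- There is a constant C such that for every f ∈ 𝓗̇¹ the free Dirac flow satisfies the endpoint Strichartz estimate ‖e^{it𝒟}f‖_{L²_t L^∞_x} ≤ C‖f‖_{Ḣ¹}. -/

import Mathlib

noncomputable section

open MeasureTheory Real Complex Filter Matrix
open scoped FourierTransform ENNReal NNReal

attribute [local instance] Matrix.normedAddCommGroup

/-- Euclidean space `ℝ³`. -/
abbrev R3 : Type := EuclideanSpace ℝ (Fin 3)

/-- Spinors: elements of `ℂ⁴`. -/
abbrev Spinor : Type := Fin 4 → ℂ

/-- The Pauli matrices. -/
def pauli : Fin 3 → Matrix (Fin 2) (Fin 2) ℂ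
  | 0 => !![0, 1; 1, 0]
  | 1 => !![0, -Complex.I; Complex.I, 0]
  | 2 => !![1, 0; 0, -1]

/-- The Dirac matrices `αₖ = [[0,σₖ],[σₖ,0]]` in 2×2 block form. -/
def diracAlpha (k : Fin 3) : Matrix (Fin 4) (Fin 4) ℂ :=
  (Matrix.reindex finSumFinEquiv finSumFinEquiv
    (Matrix.fromBlocks 0 (pauli k) (pauli k) 0) : Matrix (Fin 4) (Fin 4) ℂ)

/-- The Dirac matrix `β = [[I₂,0],[0,−I₂]]`. -/
def diracBeta : Matrix (Fin 4) (Fin 4) ℂ :=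
  (Matrix.reindex finSumFinEquiv finSumFinEquiv
    (Matrix.fromBlocks (1 : Matrix (Fin 2) (Fin 2) ℂ) 0 0 (-1 : Matrix (Fin 2) (Fin 2) ℂ)) : Matrix (Fin 4) (Fin 4) ℂ)

/-- The matrix `γ₅ = [[0,I₂],[I₂,0]]`. -/
def gamma5 : Matrix (Fin 4) (Fin 4) ℂ :=
  (Matrix.reindex finSumFinEquiv finSumFinEquiv
    (Matrix.fromBlocks (0 : Matrix (Fin 2) (Fin 2) ℂ) 1 1 (0 : Matrix (Fin 2) (Fin 2) ℂ)) : Matrix (Fin 4) (Fin 4) ℂ)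

/-- `α·a = a₁α₁ + a₂α₂ + a₃α₃` for a real vector `a`. -/
def alphaD (a : Fin 3 → ℝ) : Matrix (Fin 4) (Fin 4) ℂ :=
  ∑ k, (a k : ℂ) • diracAlpha k

/-- The partial derivative `∂ₖ` of a spinor field. -/
def pd (k : Fin 3) (u : R3 → Spinor) (x : R3) : Spinor :=
  fderiv ℝ u x (EuclideanSpace.single k 1)

/-- The free Dirac operator `𝒟 = −i Σₖ αₖ ∂ₖ`. -/
def diracOp (u : R3 → Spinor) (x : R3) : Spinor :=
  (-Complex.I) • ∑ k, (diracAlpha k).mulVec (pd k u x)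

/-- The symbol `cos(t|ξ|)I₄ + i sin(t|ξ|)(α·ξ)/|ξ|` of the free Dirac propagator. -/
def diracSymb (t : ℝ) (ξ : R3) : Matrix (Fin 4) (Fin 4) ℂ :=
  (Real.cos (t * ‖ξ‖) : ℂ) • 1 +
    (Complex.I * (Real.sin (t * ‖ξ‖) : ℂ) / (‖ξ‖ : ℂ)) • alphaD (fun k => ξ k)

/-- The free Dirac propagator `e^{it𝒟}`, as the Fourier multiplier with matrix symbol
`cos(t|ξ|)I₄ + i sin(t|ξ|)(α·ξ)/|ξ|`. -/
def diracProp (t : ℝ) (f : R3 → Spinor) : R3 → Spinor :=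
  𝓕⁻ fun ξ => (diracSymb t ξ).mulVec (𝓕 f ξ)

/-- The homogeneous Sobolev norm `‖f‖_{Ḣˢ} = ‖ |ξ|ˢ f̂(ξ) ‖_{L²}`. -/
def hSob (s : ℝ) (f : R3 → Spinor) : ℝ≥0∞ :=
  eLpNorm (fun ξ : R3 => ‖ξ‖ ^ s • 𝓕 f ξ) 2 volume

/-- The mixed norm `‖u‖_{L²_t L^∞_x}`. -/
def L2Linf (u : ℝ → R3 → Spinor) : ℝ≥0∞ :=
  (∫⁻ t : ℝ, (eLpNorm (u t) ⊤ volume) ^ 2) ^ (1/2 : ℝ)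

/-- The mixed norm `‖u‖_{L²_t L²_x}`. -/
def L2L2 (u : ℝ → R3 → Spinor) : ℝ≥0∞ :=
  (∫⁻ t : ℝ, (eLpNorm (u t) 2 volume) ^ 2) ^ (1/2 : ℝ)

/-- A function on `ℝ³` is radial if it depends only on `|x|`. -/
def IsRadial {E : Type*} (f : R3 → E) : Prop :=
  ∀ x y : R3, ‖x‖ = ‖y‖ → f x = f y

/-- The class `𝓗̇¹`: `f = f₁ + 𝒟f₂` with `f₁ ∈ Ḣ¹`, `f₂ ∈ Ḣ²`, componentwise radial. -/
def Hclass (f : R3 → Spinor) : Prop :=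
  ∃ f₁ f₂ : R3 → Spinor,
    (∀ j, IsRadial fun x => f₁ x j) ∧ (∀ j, IsRadial fun x => f₂ x j) ∧
    hSob 1 f₁ < ⊤ ∧ hSob 2 f₂ < ⊤ ∧ f = f₁ + fun x => diracOp f₂ x

/-- The potential `V(x) = V₁(|x|)I₄ + iβ(α·x̂)V₂(|x|)`. -/
def potential (V₁ V₂ : ℝ → ℝ) (x : R3) : Matrix (Fin 4) (Fin 4) ℂ :=
  (V₁ ‖x‖ : ℂ) • 1 +
    (Complex.I * (V₂ ‖x‖ : ℂ)) • (diracBeta * alphaD fun k => ‖x‖⁻¹ * x k)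

/-- The size assumption `|V(x)| ≤ δ/(|x|^{1/2}|log|x||^{σ/2} + |x|^σ)`. -/
def VBound (σ δ : ℝ) (V : R3 → Matrix (Fin 4) (Fin 4) ℂ) : Prop :=
  ∀ x : R3, x ≠ 0 →
    ‖V x‖ ≤ δ / (‖x‖ ^ (1/2 : ℝ) * |Real.log ‖x‖| ^ (σ/2) + ‖x‖ ^ σ)

/-- On `L¹ ∩ L²` the `L²` Fourier transform is given by the Fourier integral. -/
lemma coeFn_fourier_toLp_ae_eq {g : ℝ → ℂ} (h1 : Integrable g) (h2 : MemLp g 2) :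
    (𝓕 (h2.toLp g) : Lp ℂ 2 (volume : Measure ℝ)) =ᵐ[volume] 𝓕 g := by
  have hc : Continuous (𝓕 g) := VectorFourier.fourierIntegral_continuous
    Real.continuous_fourierChar (by fun_prop) h1
  refine ae_eq_of_integral_contDiff_smul_eq ?_ hc.locallyIntegrable ?_
  · exact (Lp.memLp (𝓕 (h2.toLp g))).locallyIntegrable (by norm_num)
  intro φ hφ hφc
  have hφ' : HasCompactSupport (fun x => (φ x : ℂ)) :=
    hφc.comp_left (g := fun r : ℝ => (r : ℂ)) (by simp)
  let ψ : SchwartzMap ℝ ℂ := hφ'.toSchwartzMap (Complex.ofRealCLM.contDiff.comp hφ)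
  have hψ : ∀ x, ψ x = φ x := fun x => rfl
  have e1 := congrArg (fun T => T ψ) (Lp.fourier_toTemperedDistribution_eq (h2.toLp g))
  simp only [TemperedDistribution.fourier_apply, Lp.toTemperedDistribution_apply] at e1
  have e2 : ∫ x, (𝓕 ψ) x • (h2.toLp g) x = ∫ x, (𝓕 ψ) x • g x := by
    refine integral_congr_ae ?_
    filter_upwards [h2.coeFn_toLp] with x hx
    rw [hx]
  have e3 := VectorFourier.integral_fourierIntegral_smul_eq_flip (L := innerₗ ℝ)
    (μ := volume) (ν := volume) (f := ψ) (g := g) Real.continuous_fourierChar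
    (by fun_prop) ψ.integrable h1
  rw [e2] at e1
  have e4 : ∫ x, (𝓕 ψ) x • g x = ∫ x, ψ x • 𝓕 g x := by
    simpa [SchwartzMap.fourier_coe] using! e3
  rw [e4] at e1
  simpa [hψ] using e1.symm

lemma eLpNorm_fourier_eq {g : ℝ → ℂ} (h1 : Integrable g) (h2 : MemLp g 2) :
    eLpNorm (𝓕 g) 2 volume = eLpNorm g 2 volume := by
  rw [← eLpNorm_congr_ae (coeFn_fourier_toLp_ae_eq h1 h2), ← Lp.enorm_def,
    ← eLpNorm_congr_ae h2.coeFn_toLp, ← Lp.enorm_def, ← ofReal_norm, Lp.norm_fourier_eq,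
    ofReal_norm]

lemma eLpNorm_fourierInv_eq {g : ℝ → ℂ} (h1 : Integrable g) (h2 : MemLp g 2) :
    eLpNorm (𝓕⁻ g) 2 volume = eLpNorm g 2 volume := by
  have hc : Continuous (𝓕 g) := VectorFourier.fourierIntegral_continuous
    Real.continuous_fourierChar (by fun_prop) h1
  rw [← eLpNorm_fourier_eq h1 h2,
    show 𝓕⁻ g = 𝓕 g ∘ Neg.neg from funext fun x => Real.fourierInv_eq_fourier_neg g x]
  exact eLpNorm_comp_measurePreserving hc.aestronglyMeasurable (Measure.measurePreserving_neg _)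

/-- The centred maximal function along dyadic radii (normalised by the radius). -/
def maximalFn (g : ℝ → ℝ≥0∞) (t : ℝ) : ℝ≥0∞ :=
  ⨆ k : ℤ, (∫⁻ s in Metric.closedBall t ((2 : ℝ) ^ k), g s) / ENNReal.ofReal ((2 : ℝ) ^ k)

lemma measurable_maximalFn {g : ℝ → ℝ≥0∞} (hg : Measurable g) : Measurable (maximalFn g) := by
  refine Measurable.iSup fun k => Measurable.div_const ?_ _
  have hs : MeasurableSet {p : ℝ × ℝ | dist p.2 p.1 ≤ (2 : ℝ) ^ k} :=
    measurableSet_le (by fun_prop) measurable_const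
  have h : (fun t : ℝ => ∫⁻ s in Metric.closedBall t ((2 : ℝ) ^ k), g s) =
      fun t => ∫⁻ s, {p : ℝ × ℝ | dist p.2 p.1 ≤ (2 : ℝ) ^ k}.indicator (fun p => g p.2) (t, s) := by
    ext t
    rw [← lintegral_indicator Metric.isClosed_closedBall.measurableSet]
    rfl
  rw [h]
  exact ((hg.comp measurable_snd).indicator hs).lintegral_prod_right'

lemma setLIntegral_closedBall_le_maximalFn (g : ℝ → ℝ≥0∞) (t : ℝ) {r : ℝ} (hr : 0 < r) :
    ∫⁻ s in Metric.closedBall t r, g s ≤ 2 * ENNReal.ofReal r * maximalFn g t := by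
  obtain ⟨n, hn⟩ := exists_mem_Ioc_zpow hr one_lt_two
  have hp : (0 : ℝ) < 2 ^ (n + 1) := by positivity
  have h1 : ∫⁻ s in Metric.closedBall t r, g s ≤
      ∫⁻ s in Metric.closedBall t ((2 : ℝ) ^ (n + 1)), g s :=
    lintegral_mono_set (Metric.closedBall_subset_closedBall hn.2)
  have h2 : (∫⁻ s in Metric.closedBall t ((2 : ℝ) ^ (n + 1)), g s) /
      ENNReal.ofReal ((2 : ℝ) ^ (n + 1)) ≤ maximalFn g t :=
    le_iSup (fun k : ℤ => (∫⁻ s in Metric.closedBall t ((2 : ℝ) ^ k), g s) /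
      ENNReal.ofReal ((2 : ℝ) ^ k)) (n + 1)
  rw [ENNReal.div_le_iff (by simpa using hp) ENNReal.ofReal_ne_top] at h2
  refine h1.trans (h2.trans ?_)
  rw [mul_comm]
  gcongr
  rw [show (2 : ℝ≥0∞) = ENNReal.ofReal 2 by simp, ← ENNReal.ofReal_mul (by norm_num)]
  apply ENNReal.ofReal_le_ofReal
  rw [zpow_add_one₀ (by norm_num)]
  linarith [hn.1]

lemma maximalFn_add_const_le (g : ℝ → ℝ≥0∞) (c : ℝ≥0∞) (t : ℝ) :
    maximalFn (fun s => g s + c) t ≤ maximalFn g t + 2 * c := by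
  refine iSup_le fun k => ?_
  have hp : (0 : ℝ) < 2 ^ k := by positivity
  rw [lintegral_add_right _ measurable_const, ENNReal.add_div]
  gcongr
  · exact le_iSup (fun k : ℤ => (∫⁻ s in Metric.closedBall t ((2 : ℝ) ^ k), g s) /
      ENNReal.ofReal ((2 : ℝ) ^ k)) k
  · rw [setLIntegral_const, Real.volume_closedBall, ENNReal.ofReal_mul (by norm_num), mul_comm c,
      mul_right_comm, mul_div_assoc, ENNReal.div_self (by simpa using hp) ENNReal.ofReal_ne_top]
    simp

lemma maximalFn_mono {g g' : ℝ → ℝ≥0∞} (h : ∀ s, g s ≤ g' s) (t : ℝ) :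
    maximalFn g t ≤ maximalFn g' t :=
  iSup_mono fun _ => ENNReal.div_le_div_right (lintegral_mono h) _

lemma maximalFn_le_of_le {g : ℝ → ℝ≥0∞} {c : ℝ≥0∞} (h : ∀ s, g s ≤ c) (t : ℝ) :
    maximalFn g t ≤ 2 * c := by
  refine (maximalFn_mono (g' := fun s => 0 + c) (by simpa using h) t).trans
    ((maximalFn_add_const_le _ _ _).trans ?_)
  simp [maximalFn]

/-- The weak type `(1,1)` bound for the maximal function. -/
lemma mul_volume_lt_maximalFn_le (g : ℝ → ℝ≥0∞) (hg : ∫⁻ s, g s ≠ ⊤) {c : ℝ≥0∞} (hc : c ≠ 0)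
    (hc' : c ≠ ⊤) : c * volume {t | c < maximalFn g t} ≤ 10 * ∫⁻ s, g s := by
  have hex : ∀ t ∈ {t | c < maximalFn g t}, ∃ k : ℤ, c * ENNReal.ofReal ((2 : ℝ) ^ k) <
      ∫⁻ s in Metric.closedBall t ((2 : ℝ) ^ k), g s := by
    intro t ht
    obtain ⟨k, hk⟩ := lt_iSup_iff.1 (show c < maximalFn g t from ht)
    have hp : (0 : ℝ) < 2 ^ k := by positivity
    exact ⟨k, (ENNReal.lt_div_iff_mul_lt (Or.inl (by simpa using hp))
      (Or.inl ENNReal.ofReal_ne_top)).1 hk⟩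
  choose! k hk using hex
  obtain ⟨u, hu, hdisj, hcov⟩ := Vitali.exists_disjoint_subfamily_covering_enlargement_closedBall
    {t | c < maximalFn g t} id (fun t => (2 : ℝ) ^ k t) ((∫⁻ s, g s) / c).toReal
    (by
      intro t ht
      have h1 := (hk t ht).le.trans (setLIntegral_le_lintegral _ g)
      rw [mul_comm] at h1
      refine (ENNReal.ofReal_le_iff_le_toReal (ENNReal.div_ne_top hg hc)).1 ?_
      exact (ENNReal.le_div_iff_mul_le (Or.inl hc) (Or.inl hc')).2 h1)
    5 (by norm_num)
  have hcount : u.Countable := hdisj.countable_of_nonempty_interior fun t _ => by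
    rw [interior_closedBall _ (by positivity : (2 : ℝ) ^ k t ≠ 0)]
    exact Metric.nonempty_ball.2 (by positivity)
  have hsub : {t | c < maximalFn g t} ⊆ ⋃ t ∈ u, Metric.closedBall t (5 * (2 : ℝ) ^ k t) := by
    intro t ht
    obtain ⟨b, hb, hb'⟩ := hcov t ht
    exact Set.mem_biUnion hb (hb' (Metric.mem_closedBall_self (by positivity)))
  calc c * volume {t | c < maximalFn g t}
      ≤ c * ∑' t : u, volume (Metric.closedBall (t : ℝ) (5 * (2 : ℝ) ^ k t)) := by
        gcongr
        exact (measure_mono hsub).trans (measure_biUnion_le _ hcount _)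
    _ = ∑' t : u, c * volume (Metric.closedBall (t : ℝ) (5 * (2 : ℝ) ^ k t)) :=
        ENNReal.tsum_mul_left.symm
    _ ≤ ∑' t : u, 10 * ∫⁻ s in Metric.closedBall (t : ℝ) ((2 : ℝ) ^ k t), g s := by
        refine ENNReal.tsum_le_tsum fun t => ?_
        rw [Real.volume_closedBall, ← mul_assoc, ENNReal.ofReal_mul (by norm_num), mul_left_comm]
        refine mul_le_mul' ?_ (hk t (hu t.2)).le
        norm_num
    _ = 10 * ∫⁻ s in ⋃ t ∈ u, Metric.closedBall t ((2 : ℝ) ^ k t), g s := by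
        rw [ENNReal.tsum_mul_left, lintegral_biUnion hcount
          (s := fun t => Metric.closedBall t ((2 : ℝ) ^ k t))
          (fun _ _ => Metric.isClosed_closedBall.measurableSet) hdisj]
    _ ≤ 10 * ∫⁻ s, g s := by
        gcongr
        exact Measure.restrict_le_self

/-- The `L²` bound for the maximal function of a bounded function. -/
lemma lintegral_maximalFn_sq_le {g : ℝ → ℝ≥0∞} (hg : Measurable g) {b : ℝ≥0∞} (hb : b ≠ ⊤)
    (hgb : ∀ s, g s ≤ b) : ∫⁻ t, maximalFn g t ^ 2 ≤ 160 * ∫⁻ s, g s ^ 2 := by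
  by_cases hfin : ∫⁻ s, g s ^ 2 = ⊤
  · simp [hfin]
  have hM : ∀ t, maximalFn g t ≠ ⊤ := fun t =>
    ne_top_of_le_ne_top (ENNReal.mul_ne_top (by norm_num) hb) (maximalFn_le_of_le hgb t)
  have hcake := lintegral_rpow_eq_lintegral_meas_lt_mul (volume : Measure ℝ)
    (f := fun t => (maximalFn g t).toReal) (p := 2) (ae_of_all _ fun _ => ENNReal.toReal_nonneg)
    (measurable_maximalFn hg).ennreal_toReal.aemeasurable (by norm_num)
  have hl : ∀ t, ENNReal.ofReal ((maximalFn g t).toReal ^ (2 : ℝ)) = maximalFn g t ^ 2 := by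
    intro t
    rw [Real.rpow_two, ENNReal.ofReal_pow ENNReal.toReal_nonneg, ENNReal.ofReal_toReal (hM t)]
  simp_rw [hl] at hcake
  rw [hcake]
  have key : ∀ l ∈ Set.Ioi (0 : ℝ), volume {t | l < (maximalFn g t).toReal} *
      ENNReal.ofReal (l ^ ((2 : ℝ) - 1)) ≤
      20 * ∫⁻ s, {p : ℝ × ℝ | ENNReal.ofReal p.1 < 4 * g p.2}.indicator (fun p => g p.2) (l, s) := by
    intro l hl
    have hl0 : 0 < l := hl
    set c := ENNReal.ofReal l with hcdef
    have hc0 : c ≠ 0 := by simpa [hcdef] using hl0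
    have hct : c ≠ ⊤ := ENNReal.ofReal_ne_top
    set g₁ : ℝ → ℝ≥0∞ := fun s =>
      {p : ℝ × ℝ | ENNReal.ofReal p.1 < 4 * g p.2}.indicator (fun p => g p.2) (l, s) with hg₁
    have hg₁' : ∀ s, g₁ s = if c < 4 * g s then g s else 0 := by
      intro s
      simp [hg₁, Set.indicator_apply, hcdef]
    have hle : ∀ s, g s ≤ g₁ s + c / 4 := by
      intro s
      rw [hg₁']
      split_ifs with h
      · exact le_self_add
      · rw [zero_add, ENNReal.le_div_iff_mul_le (by norm_num) (by norm_num), mul_comm]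
        exact not_lt.1 h
    have hint : ∫⁻ s, g₁ s ≠ ⊤ := by
      have hb2 : ∀ s, g₁ s ≤ 4 / c * g s ^ 2 := by
        intro s
        rw [hg₁']
        split_ifs with h
        · calc g s = c / c * g s := by rw [ENNReal.div_self hc0 hct, one_mul]
            _ ≤ (4 * g s) / c * g s := by gcongr
            _ = 4 / c * g s ^ 2 := by simp only [div_eq_mul_inv]; ring
        · exact zero_le
      refine ne_top_of_le_ne_top ?_ (lintegral_mono hb2)
      rw [lintegral_const_mul _ (hg.pow_const 2)]
      exact ENNReal.mul_ne_top (ENNReal.div_ne_top (by norm_num) hc0) hfin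
    have hsub : {t | l < (maximalFn g t).toReal} ⊆ {t | c / 2 < maximalFn g₁ t} := by
      intro t ht
      have h1 : c < maximalFn g t := (ENNReal.ofReal_lt_iff_lt_toReal hl0.le (hM t)).2 ht
      have h2 : maximalFn g t ≤ maximalFn g₁ t + c / 2 := by
        refine (maximalFn_mono hle t).trans ((maximalFn_add_const_le _ _ _).trans_eq ?_)
        congr 1
        rw [show (4 : ℝ≥0∞) = 2 * 2 by norm_num, div_eq_mul_inv, div_eq_mul_inv,
          ENNReal.mul_inv (by simp) (by simp), mul_left_comm, ← mul_assoc 2 2⁻¹,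
          ENNReal.mul_inv_cancel (by simp) (by simp), one_mul]
      by_contra h3
      have h4 : maximalFn g₁ t ≤ c / 2 := not_lt.1 h3
      have := h2.trans (add_le_add_left h4 (c / 2))
      rw [ENNReal.add_halves] at this
      exact absurd h1 (not_lt.2 this)
    have hw := mul_volume_lt_maximalFn_le g₁ hint (c := c / 2)
      (by simpa using hc0) (ENNReal.div_ne_top hct (by simp))
    have hexp : ENNReal.ofReal (l ^ ((2 : ℝ) - 1)) = 2 * (c / 2) := by
      rw [ENNReal.mul_div_cancel (by simp) (by simp)]
      norm_num [hcdef]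
    rw [hexp, mul_comm]
    calc 2 * (c / 2) * volume {t | l < (maximalFn g t).toReal}
        ≤ 2 * (c / 2 * volume {t | c / 2 < maximalFn g₁ t}) := by
          rw [mul_assoc]; gcongr
      _ ≤ 2 * (10 * ∫⁻ s, g₁ s) := by gcongr
      _ = 20 * ∫⁻ s, g₁ s := by rw [← mul_assoc]; norm_num
  have hS : MeasurableSet {p : ℝ × ℝ | ENNReal.ofReal p.1 < 4 * g p.2} :=
    measurableSet_lt (by fun_prop) (by fun_prop)
  have hind : Measurable ({p : ℝ × ℝ | ENNReal.ofReal p.1 < 4 * g p.2}.indicator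
      (fun p => g p.2)) := (hg.comp measurable_snd).indicator hS
  calc ENNReal.ofReal 2 * ∫⁻ l in Set.Ioi (0 : ℝ), volume {t | l < (maximalFn g t).toReal} *
        ENNReal.ofReal (l ^ ((2 : ℝ) - 1))
      ≤ ENNReal.ofReal 2 * ∫⁻ l in Set.Ioi (0 : ℝ), 20 * ∫⁻ s,
        {p : ℝ × ℝ | ENNReal.ofReal p.1 < 4 * g p.2}.indicator (fun p => g p.2) (l, s) := by
        gcongr 1
        exact setLIntegral_mono' measurableSet_Ioi key
    _ = ENNReal.ofReal 2 * (20 * ∫⁻ s, ∫⁻ l in Set.Ioi (0 : ℝ),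
        {p : ℝ × ℝ | ENNReal.ofReal p.1 < 4 * g p.2}.indicator (fun p => g p.2) (l, s)) := by
        rw [lintegral_const_mul _ hind.lintegral_prod_right', lintegral_lintegral_swap]
        exact hind.aemeasurable
    _ ≤ ENNReal.ofReal 2 * (20 * ∫⁻ s, 4 * g s ^ 2) := by
        gcongr with s
        have hgs : g s ≠ ⊤ := ne_top_of_le_ne_top hb (hgb s)
        calc ∫⁻ l in Set.Ioi (0 : ℝ), {p : ℝ × ℝ | ENNReal.ofReal p.1 < 4 * g p.2}.indicator
              (fun p => g p.2) (l, s)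
            ≤ ∫⁻ l in Set.Ioi (0 : ℝ),
              (Set.Iio (4 * g s).toReal).indicator (fun _ => g s) l := by
              refine setLIntegral_mono' measurableSet_Ioi fun l hl => ?_
              simp only [Set.indicator_apply, Set.mem_ofPred_eq, Set.mem_Iio]
              have hiff := ENNReal.ofReal_lt_iff_lt_toReal (le_of_lt hl)
                (ENNReal.mul_ne_top (by norm_num : (4 : ℝ≥0∞) ≠ ⊤) hgs)
              simp only [hiff, le_refl]
          _ = g s * (4 * g s) := by
              rw [lintegral_indicator measurableSet_Iio, setLIntegral_const,
                Measure.restrict_apply measurableSet_Iio, Set.inter_comm, Set.Ioi_inter_Iio,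
                Real.volume_Ioo, sub_zero, ENNReal.ofReal_toReal
                (ENNReal.mul_ne_top (by norm_num) hgs)]
          _ = 4 * g s ^ 2 := by ring
    _ = 160 * ∫⁻ s, g s ^ 2 := by
        rw [lintegral_const_mul _ (hg.pow_const 2), ← mul_assoc, ← mul_assoc]
        norm_num

lemma lintegral_prod_sq_add_sq {H : ℝ → ℝ≥0∞} (hH : Measurable H) :
    ∫⁻ p : ℝ × ℝ, H (p.1 ^ 2 + p.2 ^ 2) =
      ENNReal.ofReal (2 * π) * ∫⁻ r in Set.Ioi (0 : ℝ), ENNReal.ofReal r * H (r ^ 2) := by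
  rw [← lintegral_comp_polarCoord_symm]
  have h1 : ∀ p : ℝ × ℝ, ENNReal.ofReal p.1 • H ((polarCoord.symm p).1 ^ 2 +
      (polarCoord.symm p).2 ^ 2) = ENNReal.ofReal p.1 * H (p.1 ^ 2) := by
    intro p
    rw [polarCoord_symm_apply, smul_eq_mul]
    congr 2
    nlinarith [Real.sin_sq_add_cos_sq p.2]
  simp_rw [h1]
  rw [polarCoord_target, Measure.volume_eq_prod, ← Measure.prod_restrict,
    lintegral_prod _ (by fun_prop)]
  simp only [lintegral_const, Measure.restrict_apply MeasurableSet.univ, Set.univ_inter,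
    Real.volume_Ioo]
  rw [lintegral_mul_const _ (by fun_prop), mul_comm]
  congr 2
  ring

lemma measurePreserving_euclidean_coords :
    MeasurePreserving (fun ξ : R3 => (ξ 0, ξ 1, ξ 2)) volume volume := by
  have h1 := PiLp.volume_preserving_ofLp (Fin 3)
  have h2 := volume_preserving_piFinSuccAbove (fun _ : Fin 3 => ℝ) 0
  have h3 := (MeasurePreserving.id (volume : Measure ℝ)).prod (volume_preserving_finTwoArrow ℝ)
  exact (h3.comp h2).comp h1

lemma lintegral_Ioi_sqrt (z : ℝ) (F : ℝ → ℝ≥0∞) :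
    ∫⁻ r in Set.Ioi (0 : ℝ), ENNReal.ofReal r * F √(z ^ 2 + r ^ 2) =
      ∫⁻ ρ in Set.Ioi |z|, ENNReal.ofReal ρ * F ρ := by
  have himg : (fun r : ℝ => √(z ^ 2 + r ^ 2)) '' Set.Ioi 0 = Set.Ioi |z| := by
    ext ρ
    simp only [Set.mem_image, Set.mem_Ioi]
    constructor
    · rintro ⟨r, hr, rfl⟩
      rw [← Real.sqrt_sq_eq_abs]
      exact Real.sqrt_lt_sqrt (sq_nonneg z) (by nlinarith)
    · intro h
      have hρ : 0 < ρ := (abs_nonneg z).trans_lt h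
      have h2 : 0 < ρ ^ 2 - z ^ 2 := by
        rw [← sq_abs z]
        nlinarith [abs_nonneg z]
      exact ⟨√(ρ ^ 2 - z ^ 2), Real.sqrt_pos.2 h2, by
        rw [Real.sq_sqrt h2.le, add_sub_cancel, Real.sqrt_sq hρ.le]⟩
  have hpos : ∀ r ∈ Set.Ioi (0 : ℝ), 0 < z ^ 2 + r ^ 2 := fun r hr => by
    have : 0 < r := hr
    positivity
  rw [← himg, lintegral_image_eq_lintegral_abs_deriv_mul (f' := fun r => r / √(z ^ 2 + r ^ 2))
    measurableSet_Ioi]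
  · refine setLIntegral_congr_fun measurableSet_Ioi fun r hr => ?_
    have hr' : 0 < r := hr
    have hs := Real.sqrt_pos.2 (hpos r hr)
    rw [← mul_assoc, ← ENNReal.ofReal_mul (abs_nonneg _), abs_of_pos (by positivity),
      div_mul_cancel₀ _ hs.ne']
  · intro r hr
    have h := ((hasDerivAt_pow 2 r).const_add (z ^ 2)).sqrt (hpos r hr).ne'
    refine (h.congr_deriv ?_).hasDerivWithinAt
    have hs := Real.sqrt_pos.2 (hpos r hr)
    field_simp
    simp
  · intro a ha b hb hab
    have h := (Real.sqrt_inj (hpos a ha).le (hpos b hb).le).1 hab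
    have ha' : 0 < a := ha
    have hb' : 0 < b := hb
    nlinarith

lemma lintegral_Ioo_div {ρ : ℝ} (hρ : 0 < ρ) (φ : ℝ → ℝ≥0∞) :
    ∫⁻ z in Set.Ioo (-ρ) ρ, φ (z / ρ) = ENNReal.ofReal ρ * ∫⁻ s in Set.Ioo (-1 : ℝ) 1, φ s := by
  have himg : (fun s : ℝ => ρ * s) '' Set.Ioo (-1) 1 = Set.Ioo (-ρ) ρ := by
    rw [Set.image_mul_left_Ioo hρ]; simp
  rw [← himg, lintegral_image_eq_lintegral_abs_deriv_mul (f' := fun _ => ρ) measurableSet_Ioo]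
  · rw [← lintegral_const_mul' _ _ ENNReal.ofReal_ne_top]
    simp_rw [abs_of_pos hρ, mul_div_cancel_left₀ _ hρ.ne']
  · intro s _
    simpa using ((hasDerivAt_id s).const_mul ρ).hasDerivWithinAt
  · intro a _ b _ hab
    exact mul_left_cancel₀ hρ.ne' hab

/-- Spherical coordinates on `ℝ³` for a function of `‖ξ‖` and of the cosine of the angle between
`ξ` and a fixed axis. -/
lemma lintegral_norm_cos {e : R3} (he : ‖e‖ = 1) {F : ℝ × ℝ → ℝ≥0∞} (hF : Measurable F) :
    ∫⁻ ξ : R3, F (‖ξ‖, inner ℝ e ξ / ‖ξ‖) =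
      ∫⁻ ρ in Set.Ioi (0 : ℝ), ENNReal.ofReal (2 * π * ρ ^ 2) *
        ∫⁻ s in Set.Ioo (-1 : ℝ) 1, F (ρ, s) := by
  set e₀ : R3 := EuclideanSpace.single 0 1 with he₀
  have hA := Submodule.reflection_sub (v := e) (w := e₀) (by simp [he, he₀])
  set A : R3 ≃ₗᵢ[ℝ] R3 := (ℝ ∙ (e - e₀))ᗮ.reflection
  have hm : Measurable fun ξ : R3 => F (‖ξ‖, ξ 0 / ‖ξ‖) := by fun_prop
  have h1 : ∫⁻ ξ : R3, F (‖ξ‖, inner ℝ e ξ / ‖ξ‖) = ∫⁻ ξ : R3, F (‖ξ‖, ξ 0 / ‖ξ‖) := by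
    rw [← A.measurePreserving.lintegral_comp hm]
    refine lintegral_congr fun ξ => ?_
    rw [A.norm_map, ← A.inner_map_map e ξ, hA, he₀, EuclideanSpace.inner_single_left]
    simp
  have hG : Measurable fun p : ℝ × ℝ × ℝ =>
      F (√(p.1 ^ 2 + (p.2.1 ^ 2 + p.2.2 ^ 2)), p.1 / √(p.1 ^ 2 + (p.2.1 ^ 2 + p.2.2 ^ 2))) := by
    fun_prop
  have h2 : ∫⁻ ξ : R3, F (‖ξ‖, ξ 0 / ‖ξ‖) = ∫⁻ p : ℝ × ℝ × ℝ,
      F (√(p.1 ^ 2 + (p.2.1 ^ 2 + p.2.2 ^ 2)), p.1 / √(p.1 ^ 2 + (p.2.1 ^ 2 + p.2.2 ^ 2))) := by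
    rw [← measurePreserving_euclidean_coords.lintegral_comp hG]
    refine lintegral_congr fun ξ => ?_
    rw [EuclideanSpace.norm_eq, Fin.sum_univ_three]
    simp only [Real.norm_eq_abs, sq_abs, add_assoc]
  have h3 : ∀ z : ℝ, ∫⁻ p : ℝ × ℝ, F (√(z ^ 2 + (p.1 ^ 2 + p.2 ^ 2)),
      z / √(z ^ 2 + (p.1 ^ 2 + p.2 ^ 2))) = ENNReal.ofReal (2 * π) *
        ∫⁻ ρ in Set.Ioi |z|, ENNReal.ofReal ρ * F (ρ, z / ρ) := by
    intro z
    rw [← lintegral_Ioi_sqrt z (fun ρ => F (ρ, z / ρ))]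
    exact lintegral_prod_sq_add_sq (H := fun q => F (√(z ^ 2 + q), z / √(z ^ 2 + q)))
      (by fun_prop)
  set S : Set (ℝ × ℝ) := {p | |p.1| < p.2}
  have hS : MeasurableSet S := measurableSet_lt (by fun_prop) (by fun_prop)
  have hK : Measurable (S.indicator fun p : ℝ × ℝ => ENNReal.ofReal p.2 * F (p.2, p.1 / p.2)) :=
    Measurable.indicator (by fun_prop) hS
  rw [h1, h2, Measure.volume_eq_prod, lintegral_prod _ hG.aemeasurable]
  simp_rw [h3]
  have h4 : ∀ z : ℝ, ∫⁻ ρ in Set.Ioi |z|, ENNReal.ofReal ρ * F (ρ, z / ρ) =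
      ∫⁻ ρ, S.indicator (fun p : ℝ × ℝ => ENNReal.ofReal p.2 * F (p.2, p.1 / p.2)) (z, ρ) := by
    intro z
    rw [← lintegral_indicator measurableSet_Ioi]
    rfl
  simp_rw [h4]
  rw [lintegral_const_mul _ hK.lintegral_prod_right', lintegral_lintegral_swap (f := fun z ρ => S.indicator
      (fun p : ℝ × ℝ => ENNReal.ofReal p.2 * F (p.2, p.1 / p.2)) (z, ρ)) hK.aemeasurable,
    ← lintegral_const_mul _ hK.lintegral_prod_left', ← lintegral_indicator measurableSet_Ioi]
  refine lintegral_congr fun ρ => ?_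
  by_cases hρ : 0 < ρ
  · have h5 : ∀ z : ℝ, S.indicator (fun p : ℝ × ℝ => ENNReal.ofReal p.2 * F (p.2, p.1 / p.2))
        (z, ρ) = (Set.Ioo (-ρ) ρ).indicator (fun z => ENNReal.ofReal ρ * F (ρ, z / ρ)) z := by
      intro z
      simp [Set.indicator_apply, S, abs_lt]
    simp_rw [h5]
    rw [lintegral_indicator measurableSet_Ioo, lintegral_const_mul' _ _ ENNReal.ofReal_ne_top,
      lintegral_Ioo_div hρ (fun s => F (ρ, s)), Set.indicator_of_mem (Set.mem_Ioi.2 hρ),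
      ← mul_assoc, ← mul_assoc, ← ENNReal.ofReal_mul (by positivity),
      ← ENNReal.ofReal_mul (by positivity)]
    ring_nf
  · have h5 : ∀ z : ℝ, S.indicator (fun p : ℝ × ℝ => ENNReal.ofReal p.2 * F (p.2, p.1 / p.2))
        (z, ρ) = 0 := by
      intro z
      refine Set.indicator_of_notMem (fun h => hρ ?_) _
      exact (abs_nonneg z).trans_lt h
    simp [h5, hρ]

/-- Spherical coordinates as the image of Lebesgue measure under norm and cosine. -/
lemma measurePreserving_norm_cos {e : R3} (he : ‖e‖ = 1) :
    MeasurePreserving (fun ξ : R3 => (‖ξ‖, inner ℝ e ξ / ‖ξ‖)) volume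
      (((volume.restrict (Set.Ioi (0 : ℝ))).withDensity
        fun ρ => ENNReal.ofReal (2 * π * ρ ^ 2)).prod (volume.restrict (Set.Ioo (-1 : ℝ) 1))) := by
  have hm : Measurable (fun ξ : R3 => (‖ξ‖, inner ℝ e ξ / ‖ξ‖)) := by fun_prop
  refine ⟨hm, ?_⟩
  refine Measure.ext_of_lintegral _ fun F hF => ?_
  rw [lintegral_map hF hm, lintegral_norm_cos he hF, lintegral_prod _ hF.aemeasurable,
    lintegral_withDensity_eq_lintegral_mul _ (by fun_prop) hF.lintegral_prod_right']
  rfl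

lemma exists_linearIsometryEquiv_apply_eq {x y : R3} (h : ‖x‖ = ‖y‖) :
    ∃ A : R3 ≃ₗᵢ[ℝ] R3, A x = y :=
  ⟨(ℝ ∙ (x - y))ᗮ.reflection, Submodule.reflection_sub h⟩

/-- A field of linear maps equivariant under linear isometries only sees the radial direction. -/
lemma equivariant_apply_eq {E : Type*} [AddCommGroup E] [Module ℝ E] {D : R3 → R3 →ₗ[ℝ] E}
    (hD : ∀ (A : R3 ≃ₗᵢ[ℝ] R3) (x w : R3), D (A x) (A w) = D x w) (x w : R3) :
    D x w = (inner ℝ w x / ‖x‖) • D x (‖x‖⁻¹ • x) := by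
  set c : ℝ := inner ℝ w x / ‖x‖ ^ 2 with hc
  set y : R3 := w - c • x with hy
  have hyx : inner ℝ y x = 0 := by
    rw [hy, inner_sub_left, real_inner_smul_left, real_inner_self_eq_norm_sq, hc]
    by_cases hx : x = 0
    · simp [hx]
    · rw [div_mul_cancel₀ _ (by simpa using hx), sub_self]
  have hAx : (ℝ ∙ y)ᗮ.reflection x = x :=
    Submodule.reflection_mem_subspace_eq_self
      (Submodule.mem_orthogonal_singleton_iff_inner_right.2 hyx)
  have hAy : (ℝ ∙ y)ᗮ.reflection y = -y :=
    Submodule.reflection_orthogonalComplement_singleton_eq_neg y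
  have h0 : D x y = 0 := by
    have h := hD (ℝ ∙ y)ᗮ.reflection x y
    rw [hAx, hAy, map_neg] at h
    have h2 : (2 : ℝ) • D x y = 0 := by
      rw [two_smul]
      nth_rewrite 1 [← h]
      exact neg_add_cancel _
    exact (smul_eq_zero.1 h2).resolve_left two_ne_zero
  have hw : w = y + c • x := by rw [hy]; abel
  rw [hw, map_add, h0, zero_add, map_smul, map_smul, smul_smul, ← hw, hc]
  congr 1
  rw [sq, div_mul_eq_div_div, ← div_eq_mul_inv]

lemma equivariant_apply_radial {E : Type*} [AddCommGroup E] [Module ℝ E] {D : R3 → R3 →ₗ[ℝ] E}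
    (hD : ∀ (A : R3 ≃ₗᵢ[ℝ] R3) (x w : R3), D (A x) (A w) = D x w) {x y : R3} (h : ‖x‖ = ‖y‖) :
    D x (‖x‖⁻¹ • x) = D y (‖y‖⁻¹ • y) := by
  obtain ⟨A, rfl⟩ := exists_linearIsometryEquiv_apply_eq h
  rw [← hD A x, map_smul, h]

/-- The Fourier transform of a field of linear maps, evaluated at fixed vectors. -/
def fourierLinear {E : Type*} [NormedAddCommGroup E] [NormedSpace ℂ E] (D : R3 → R3 →ₗ[ℝ] E)
    (hint : ∀ w, Integrable fun x => D x w) (ξ : R3) : R3 →ₗ[ℝ] E where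
  toFun w := 𝓕 (fun x => D x w) ξ
  map_add' v w := by
    simp only [map_add]
    exact congrFun (VectorFourier.fourierIntegral_add Real.continuous_fourierChar
      continuous_inner (hint v) (hint w)) ξ
  map_smul' c w := by
    simp only [map_smul, RingHom.id_apply, Real.fourier_eq]
    rw [← integral_smul]
    refine integral_congr_ae (ae_of_all _ fun x => ?_)
    exact smul_comm _ _ _

lemma fourierLinear_equivariant {E : Type*} [NormedAddCommGroup E] [NormedSpace ℂ E]
    {D : R3 → R3 →ₗ[ℝ] E} (hint : ∀ w, Integrable fun x => D x w)
    (hD : ∀ (A : R3 ≃ₗᵢ[ℝ] R3) (x w : R3), D (A x) (A w) = D x w)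
    (A : R3 ≃ₗᵢ[ℝ] R3) (ξ w : R3) :
    fourierLinear D hint (A ξ) (A w) = fourierLinear D hint ξ w := by
  change 𝓕 (fun x => D x (A w)) (A ξ) = 𝓕 (fun x => D x w) ξ
  rw [← Real.fourier_comp_linearIsometry]
  refine congrArg (fun g : R3 → E => 𝓕 g _) (funext fun x => ?_)
  exact hD A x w

lemma IsRadial.comp_linearIsometryEquiv {E : Type*} {f : R3 → E} (hf : IsRadial f)
    (A : R3 ≃ₗᵢ[ℝ] R3) (x : R3) : f (A x) = f x := hf _ _ (A.norm_map x)

lemma IsRadial.fourier {E : Type*} [NormedAddCommGroup E] [NormedSpace ℂ E] {f : R3 → E}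
    (hf : IsRadial f) : IsRadial (𝓕 f) := by
  intro x y h
  obtain ⟨A, rfl⟩ := exists_linearIsometryEquiv_apply_eq h
  rw [← Real.fourier_comp_linearIsometry]
  refine congrArg (fun g : R3 → E => 𝓕 g _) (funext fun x => ?_)
  exact (hf.comp_linearIsometryEquiv A x).symm

lemma abs_inner_div_norm_le (w x : R3) : |inner ℝ w x / ‖x‖| ≤ ‖w‖ := by
  rw [abs_div, abs_norm]
  exact div_le_of_le_mul₀ (norm_nonneg _) (norm_nonneg _) (abs_real_inner_le_norm w x)

lemma measurable_inner_div_norm (w : R3) : Measurable fun x : R3 => inner ℝ w x / ‖x‖ := by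
  fun_prop

lemma integrable_inner_div_norm_smul {E : Type*} [NormedAddCommGroup E] [NormedSpace ℝ E]
    {k : R3 → E} (hk : Integrable k) (w : R3) :
    Integrable fun ξ => (inner ℝ w ξ / ‖ξ‖) • k ξ :=
  hk.bdd_smul ‖w‖ (measurable_inner_div_norm w).aestronglyMeasurable
    (ae_of_all _ fun ξ => abs_inner_div_norm_le w ξ)

/-- The inverse Fourier transform of a radial function times a coordinate of `ξ / ‖ξ‖`. -/
lemma fourierInv_inner_div_norm_smul {k : R3 → ℂ} (hk : Integrable k) (hr : IsRadial k)
    (w x : R3) :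
    𝓕⁻ (fun ξ => (inner ℝ w ξ / ‖ξ‖) • k ξ) x =
      (inner ℝ w x / ‖x‖) • 𝓕⁻ (fun ξ => (inner ℝ (‖x‖⁻¹ • x) ξ / ‖ξ‖) • k ξ) x := by
  let D : R3 → R3 →ₗ[ℝ] ℂ := fun ξ =>
    { toFun := fun w => (inner ℝ w ξ / ‖ξ‖) • k ξ
      map_add' := fun v w => by rw [inner_add_left, add_div, add_smul]
      map_smul' := fun c w => by rw [real_inner_smul_left, mul_div_assoc, mul_smul]; rfl }
  have hint : ∀ w, Integrable fun ξ => D ξ w := fun w => integrable_inner_div_norm_smul hk w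
  have hD : ∀ (A : R3 ≃ₗᵢ[ℝ] R3) (x w : R3), D (A x) (A w) = D x w := by
    intro A x w
    change (inner ℝ (A w) (A x) / ‖A x‖) • k (A x) = (inner ℝ w x / ‖x‖) • k x
    rw [A.inner_map_map, A.norm_map, hr.comp_linearIsometryEquiv]
  have h := equivariant_apply_eq (fourierLinear_equivariant hint hD) (-x) w
  rw [norm_neg, smul_neg, map_neg, inner_neg_right, neg_div, neg_smul, smul_neg, neg_neg] at h
  rw [Real.fourierInv_eq_fourier_neg, Real.fourierInv_eq_fourier_neg]
  exact h

/-- The density `ρ² h(ρ)` on the half-line of a radial function `h` on `ℝ³`. -/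
def radialProfile (h : R3 → ℂ) : ℝ → ℂ :=
  (Set.Ioi 0).indicator fun ρ => (ρ : ℂ) ^ 2 * h (EuclideanSpace.single 0 ρ)

lemma IsRadial.eq_single {E : Type*} {h : R3 → E} (hr : IsRadial h) (ξ : R3) :
    h ξ = h (EuclideanSpace.single 0 ‖ξ‖) := hr _ _ (by simp)

lemma measurable_euclideanSpace_single :
    Measurable fun ρ : ℝ => (EuclideanSpace.single 0 ρ : R3) := by
  have : (fun ρ : ℝ => (EuclideanSpace.single 0 ρ : R3)) =
      fun ρ => ρ • (EuclideanSpace.single 0 1 : R3) := by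
    ext ρ i
    simp
  rw [this]
  fun_prop

lemma measurable_radialProfile {h : R3 → ℂ} (hm : Measurable h) : Measurable (radialProfile h) :=
  Measurable.indicator ((by fun_prop : Measurable fun ρ : ℝ => (ρ : ℂ) ^ 2).mul
    (hm.comp measurable_euclideanSpace_single)) measurableSet_Ioi

lemma lintegral_fun_norm {F : ℝ → ℝ≥0∞} (hF : Measurable F) :
    ∫⁻ ξ : R3, F ‖ξ‖ =
      ENNReal.ofReal (4 * π) * ∫⁻ ρ in Set.Ioi (0 : ℝ), ENNReal.ofReal (ρ ^ 2) * F ρ := by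
  have h := lintegral_norm_cos (e := EuclideanSpace.single 0 1) (by simp)
    (F := fun p => F p.1) (by fun_prop)
  simp only [lintegral_const, Measure.restrict_apply MeasurableSet.univ, Set.univ_inter,
    Real.volume_Ioo] at h
  rw [h, ← lintegral_const_mul' _ _ ENNReal.ofReal_ne_top]
  refine lintegral_congr fun ρ => ?_
  rw [mul_comm (F ρ), ← mul_assoc, ← mul_assoc, ← ENNReal.ofReal_mul (by positivity),
    ← ENNReal.ofReal_mul (by positivity)]
  ring_nf

lemma lintegral_enorm_eq_radialProfile {h : R3 → ℂ} (hm : Measurable h) (hr : IsRadial h) :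
    ∫⁻ ξ, ‖h ξ‖ₑ = ENNReal.ofReal (4 * π) * ∫⁻ ρ, ‖radialProfile h ρ‖ₑ := by
  have h1 := lintegral_fun_norm (F := fun ρ => ‖h (EuclideanSpace.single 0 ρ)‖ₑ)
    (hm.comp measurable_euclideanSpace_single).enorm
  simp only [← hr.eq_single] at h1
  rw [h1, ← lintegral_indicator measurableSet_Ioi]
  congr 1
  refine lintegral_congr fun ρ => ?_
  by_cases hρ : ρ ∈ Set.Ioi (0 : ℝ)
  · simp only [radialProfile, Set.indicator_of_mem hρ, enorm_mul]
    congr 1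
    rw [← ofReal_norm, norm_pow, Complex.norm_real, Real.norm_eq_abs, sq_abs]
  · simp [radialProfile, Set.indicator_of_notMem hρ]

lemma lintegral_sq_eq_radialProfile {h : R3 → ℂ} (hm : Measurable h) (hr : IsRadial h) :
    ∫⁻ ξ, (‖ξ‖ₑ * ‖h ξ‖ₑ) ^ 2 = ENNReal.ofReal (4 * π) * ∫⁻ ρ, ‖radialProfile h ρ‖ₑ ^ 2 := by
  have h1 := lintegral_fun_norm (F := fun ρ => (‖ρ‖ₑ * ‖h (EuclideanSpace.single 0 ρ)‖ₑ) ^ 2)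
    ((measurable_enorm.mul (hm.comp measurable_euclideanSpace_single).enorm).pow_const 2)
  simp only [← hr.eq_single, enorm_norm] at h1
  rw [h1, ← lintegral_indicator measurableSet_Ioi]
  congr 1
  refine lintegral_congr fun ρ => ?_
  by_cases hρ : ρ ∈ Set.Ioi (0 : ℝ)
  · have hρ' : ‖ρ‖ₑ = ENNReal.ofReal ρ := by
      rw [← ofReal_norm, Real.norm_of_nonneg (le_of_lt hρ)]
    have hρc : ‖(ρ : ℂ) ^ 2‖ₑ = ENNReal.ofReal ρ ^ 2 := by
      rw [enorm_pow, ← ofReal_norm, Complex.norm_real, Real.norm_of_nonneg (le_of_lt hρ)]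
    simp only [radialProfile, Set.indicator_of_mem hρ, enorm_mul, hρc, hρ',
      ENNReal.ofReal_pow (le_of_lt hρ)]
    ring
  · simp [radialProfile, Set.indicator_of_notMem hρ]

lemma integrable_radialProfile {h : R3 → ℂ} (hm : Measurable h) (hr : IsRadial h)
    (hi : Integrable h) : Integrable (radialProfile h) := by
  refine ⟨(measurable_radialProfile hm).aestronglyMeasurable, ?_⟩
  have h1 := lintegral_enorm_eq_radialProfile hm hr
  have h2 : ∫⁻ ξ, ‖h ξ‖ₑ < ⊤ := hi.2
  rw [h1] at h2
  exact lt_top_iff_ne_top.2 fun h3 => by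
    rw [h3, ENNReal.mul_top (by simp [Real.pi_pos])] at h2
    exact lt_irrefl _ h2

/-- The half-wave evolution of radial data is an average of a function of one variable. -/
lemma fourierInv_exp_smul_eq {h : R3 → ℂ} (hm : Measurable h) (hr : IsRadial h)
    (hi : Integrable h) (n : ℕ) (t : ℝ) {x : R3} (hx : x ≠ 0) :
    𝓕⁻ (fun ξ => (inner ℝ (‖x‖⁻¹ • x) ξ / ‖ξ‖) ^ n •
      (Complex.exp ((t * ‖ξ‖ : ℝ) * Complex.I) * h ξ)) x =
      ∫ s in Set.Ioo (-1 : ℝ) 1, (2 * π * s ^ n) • 𝓕⁻ (radialProfile h) (t / (2 * π) + ‖x‖ * s) := by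
  have hx' : 0 < ‖x‖ := norm_pos_iff.2 hx
  set e : R3 := ‖x‖⁻¹ • x with he
  have he1 : ‖e‖ = 1 := by rw [he, norm_smul, norm_inv, norm_norm, inv_mul_cancel₀ hx'.ne']
  have hmp := measurePreserving_norm_cos he1
  set ν₁ : Measure ℝ := (volume.restrict (Set.Ioi (0 : ℝ))).withDensity
    fun ρ => ENNReal.ofReal (2 * π * ρ ^ 2) with hν₁
  set ν₂ : Measure ℝ := volume.restrict (Set.Ioo (-1 : ℝ) 1) with hν₂
  set Φ : ℝ × ℝ → ℂ := fun p => Complex.exp ((2 * π * (‖x‖ * (p.2 * p.1)) : ℝ) * Complex.I) •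
    (p.2 ^ n • (Complex.exp ((t * p.1 : ℝ) * Complex.I) * h (EuclideanSpace.single 0 p.1)))
    with hΦ
  have hΦm : Measurable Φ := by
    have : Measurable fun p : ℝ × ℝ => h (EuclideanSpace.single 0 p.1) :=
      hm.comp (measurable_euclideanSpace_single.comp measurable_fst)
    exact Measurable.smul (f := fun p : ℝ × ℝ =>
        Complex.exp ((2 * π * (‖x‖ * (p.2 * p.1)) : ℝ) * Complex.I)) (by fun_prop)
      (Measurable.smul (f := fun p : ℝ × ℝ => p.2 ^ n) (by fun_prop)
        (Measurable.mul (by fun_prop) this))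
  have hcomp : ∀ ξ : R3, Complex.exp ((2 * π * inner ℝ ξ x : ℝ) * Complex.I) •
      ((inner ℝ e ξ / ‖ξ‖) ^ n • (Complex.exp ((t * ‖ξ‖ : ℝ) * Complex.I) * h ξ)) =
      Φ (‖ξ‖, inner ℝ e ξ / ‖ξ‖) := by
    intro ξ
    simp only [hΦ, ← hr.eq_single]
    congr 6
    have h1 : inner ℝ e ξ / ‖ξ‖ * ‖ξ‖ = inner ℝ e ξ := by
      by_cases hξ : ξ = 0
      · simp [hξ]
      · exact div_mul_cancel₀ _ (norm_ne_zero_iff.2 hξ)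
    rw [h1, he, real_inner_smul_left, mul_inv_cancel_left₀ hx'.ne', real_inner_comm]
  have hint : Integrable Φ (ν₁.prod ν₂) := by
    rw [← hmp.map_eq, integrable_map_measure hΦm.aestronglyMeasurable hmp.measurable.aemeasurable]
    refine hi.mono (hΦm.comp hmp.measurable).aestronglyMeasurable (ae_of_all _ fun ξ => ?_)
    rw [Function.comp_apply, ← hcomp, norm_smul, norm_smul, norm_mul, Complex.norm_exp_ofReal_mul_I,
      Complex.norm_exp_ofReal_mul_I, one_mul, one_mul, norm_pow]
    refine mul_le_of_le_one_left (norm_nonneg _) (pow_le_one₀ (norm_nonneg _) ?_)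
    exact (abs_inner_div_norm_le e ξ).trans_eq he1
  rw [Real.fourierInv_eq']
  simp_rw [hcomp]
  rw [← integral_map (φ := fun ξ : R3 => (‖ξ‖, inner ℝ e ξ / ‖ξ‖)) hmp.measurable.aemeasurable
    hΦm.aestronglyMeasurable, hmp.map_eq, integral_prod_symm _ hint]
  refine integral_congr_ae (ae_of_all _ fun s => ?_)
  beta_reduce
  rw [hν₁, integral_withDensity_eq_integral_toReal_smul (by fun_prop) (by simp),
    Real.fourierInv_eq', ← integral_smul, ← integral_indicator measurableSet_Ioi]
  refine integral_congr_ae (ae_of_all _ fun ρ => ?_)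
  beta_reduce
  by_cases hρ : ρ ∈ Set.Ioi (0 : ℝ)
  · simp only [radialProfile, Set.indicator_of_mem hρ, hΦ]
    rw [ENNReal.toReal_ofReal (by positivity)]
    have hexp : Complex.exp ((2 * π * inner ℝ ρ (t / (2 * π) + ‖x‖ * s) : ℝ) * Complex.I) =
        Complex.exp ((2 * π * (‖x‖ * (s * ρ)) : ℝ) * Complex.I) *
        Complex.exp ((t * ρ : ℝ) * Complex.I) := by
      rw [← Complex.exp_add, ← add_mul, ← Complex.ofReal_add]
      congr 3
      have hin : inner ℝ ρ (t / (2 * π) + ‖x‖ * s) = (t / (2 * π) + ‖x‖ * s) * ρ := by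
        simp [mul_comm]
      rw [hin]
      field_simp
      ring
    rw [hexp]
    simp only [Complex.real_smul, smul_eq_mul]
    push_cast
    ring
  · simp [radialProfile, Set.indicator_of_notMem hρ]

lemma lintegral_Ioo_comp_le_maximalFn (φ : ℝ → ℝ≥0∞) (τ : ℝ) {r : ℝ} (hr : 0 < r) :
    ∫⁻ s in Set.Ioo (-1 : ℝ) 1, φ (τ + r * s) ≤ 2 * maximalFn φ τ := by
  have hsub : (fun s : ℝ => τ + r * s) '' Set.Ioo (-1) 1 ⊆ Metric.closedBall τ r := by
    rintro _ ⟨s, hs, rfl⟩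
    rw [Metric.mem_closedBall, Real.dist_eq, add_sub_cancel_left, abs_mul, abs_of_pos hr]
    exact mul_le_of_le_one_right hr.le (abs_le.2 ⟨hs.1.le, hs.2.le⟩)
  have h1 := lintegral_image_eq_lintegral_abs_deriv_mul (f := fun s : ℝ => τ + r * s)
    (f' := fun _ => r) (s := Set.Ioo (-1) 1) measurableSet_Ioo
    (fun s _ => by simpa using (((hasDerivAt_id s).const_mul r).const_add τ).hasDerivWithinAt)
    (fun a _ b _ hab => mul_left_cancel₀ hr.ne' (add_left_cancel hab)) φ
  rw [abs_of_pos hr, lintegral_const_mul' _ _ ENNReal.ofReal_ne_top] at h1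
  have h2 := h1.symm.le.trans
    ((lintegral_mono_set hsub).trans (setLIntegral_closedBall_le_maximalFn φ τ hr))
  rw [mul_right_comm, mul_comm _ (ENNReal.ofReal r)] at h2
  exact (ENNReal.mul_le_mul_iff_right (by simpa using hr) ENNReal.ofReal_ne_top).1 h2

lemma enorm_fourierInv_exp_smul_le {h : R3 → ℂ} (hm : Measurable h) (hr : IsRadial h)
    (hi : Integrable h) (n : ℕ) (t : ℝ) {x : R3} (hx : x ≠ 0) :
    ‖𝓕⁻ (fun ξ => (inner ℝ (‖x‖⁻¹ • x) ξ / ‖ξ‖) ^ n •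
      (Complex.exp ((t * ‖ξ‖ : ℝ) * Complex.I) * h ξ)) x‖ₑ ≤
      ENNReal.ofReal (4 * π) *
        maximalFn (fun τ => ‖𝓕⁻ (radialProfile h) τ‖ₑ) (t / (2 * π)) := by
  rw [fourierInv_exp_smul_eq hm hr hi n t hx]
  calc _ ≤ ∫⁻ s in Set.Ioo (-1 : ℝ) 1,
        ‖(2 * π * s ^ n) • 𝓕⁻ (radialProfile h) (t / (2 * π) + ‖x‖ * s)‖ₑ :=
        enorm_integral_le_lintegral_enorm _
    _ ≤ ∫⁻ s in Set.Ioo (-1 : ℝ) 1,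
        ENNReal.ofReal (2 * π) * ‖𝓕⁻ (radialProfile h) (t / (2 * π) + ‖x‖ * s)‖ₑ := by
        refine setLIntegral_mono' measurableSet_Ioo fun s hs => ?_
        rw [enorm_smul]
        gcongr
        rw [← ofReal_norm, norm_mul, norm_pow, Real.norm_of_nonneg (by positivity)]
        refine ENNReal.ofReal_le_ofReal (mul_le_of_le_one_right (by positivity) ?_)
        exact pow_le_one₀ (norm_nonneg _) (abs_le.2 ⟨hs.1.le, hs.2.le⟩)
    _ ≤ ENNReal.ofReal (2 * π) *
        (2 * maximalFn (fun τ => ‖𝓕⁻ (radialProfile h) τ‖ₑ) (t / (2 * π))) := by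
        rw [lintegral_const_mul' _ _ ENNReal.ofReal_ne_top]
        gcongr
        exact lintegral_Ioo_comp_le_maximalFn (fun τ => ‖𝓕⁻ (radialProfile h) τ‖ₑ) _
          (norm_pos_iff.2 hx)
    _ = _ := by
        rw [← mul_assoc, show (2 : ℝ≥0∞) = ENNReal.ofReal 2 by simp,
          ← ENNReal.ofReal_mul (by positivity)]
        ring_nf

lemma enorm_fourierInv_le {g : ℝ → ℂ} (τ : ℝ) : ‖𝓕⁻ g τ‖ₑ ≤ ∫⁻ ρ, ‖g ρ‖ₑ := by
  rw [Real.fourierInv_eq]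
  refine (enorm_integral_le_lintegral_enorm _).trans_eq (lintegral_congr fun ρ => ?_)
  rw [← ofReal_norm, ← ofReal_norm, Circle.norm_smul]

lemma continuous_fourierInv {g : ℝ → ℂ} (hg : Integrable g) : Continuous (𝓕⁻ g) :=
  VectorFourier.fourierIntegral_continuous Real.continuous_fourierChar (by fun_prop) hg

lemma lintegral_comp_const_mul {F : ℝ → ℝ≥0∞} (hF : Measurable F) {a : ℝ} (ha : a ≠ 0) :
    ∫⁻ t, F (a * t) = ENNReal.ofReal |a⁻¹| * ∫⁻ s, F s := by
  rw [← lintegral_map hF (measurable_const_mul a), Real.map_volume_mul_left ha,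
    lintegral_smul_measure, smul_eq_mul]

/-- The maximal function of the one-dimensional profile of a radial function is controlled in
`L²` by the homogeneous Sobolev norm of order one. -/
lemma lintegral_maximalFn_radialProfile_le {h : R3 → ℂ} (hm : Measurable h) (hr : IsRadial h)
    (hi : Integrable h) {ε : ℝ} (hε : |ε| = 1) :
    ∫⁻ t : ℝ, maximalFn (fun τ => ‖𝓕⁻ (radialProfile h) τ‖ₑ) (ε * t / (2 * π)) ^ 2 ≤
      80 * ∫⁻ ξ, (‖ξ‖ₑ * ‖h ξ‖ₑ) ^ 2 := by
  have hp := integrable_radialProfile hm hr hi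
  have hc := (continuous_fourierInv hp).measurable.enorm
  have hε0 : ε ≠ 0 := fun h0 => by simp [h0] at hε
  rw [lintegral_sq_eq_radialProfile hm hr]
  by_cases htop : ∫⁻ ρ, ‖radialProfile h ρ‖ₑ ^ 2 = ⊤
  · rw [htop, ENNReal.mul_top (by simp [Real.pi_pos]), ENNReal.mul_top (by simp)]
    exact le_top
  have hL2 : MemLp (radialProfile h) 2 := by
    refine ⟨hp.1, ?_⟩
    rw [eLpNorm_lt_top_iff_lintegral_rpow_enorm_lt_top (by simp) (by simp)]
    simpa using lt_top_iff_ne_top.2 htop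
  have hpl : ∫⁻ τ, ‖𝓕⁻ (radialProfile h) τ‖ₑ ^ 2 = ∫⁻ ρ, ‖radialProfile h ρ‖ₑ ^ 2 := by
    have h1 := eLpNorm_fourierInv_eq hp hL2
    have h2 := congrArg (· ^ 2) h1
    have key : ∀ g : ℝ → ℂ, eLpNorm g 2 volume ^ 2 = ∫⁻ ρ, ‖g ρ‖ₑ ^ 2 := fun g => by
      have := eLpNorm_nnreal_pow_eq_lintegral (μ := volume) (f := g) (p := 2) (by simp)
      simpa using this
    simpa [key] using h2
  have hb : ∀ t : ℝ, ε * t / (2 * π) = ε / (2 * π) * t := fun t => by ring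
  simp_rw [hb]
  rw [lintegral_comp_const_mul ((measurable_maximalFn hc).pow_const 2)
    (div_ne_zero hε0 (by positivity)), inv_div, abs_div, hε, div_one, abs_of_pos (by positivity)]
  calc _ ≤ ENNReal.ofReal (2 * π) * (160 * ∫⁻ ρ, ‖radialProfile h ρ‖ₑ ^ 2) := by
        gcongr
        rw [← hpl]
        exact lintegral_maximalFn_sq_le hc hp.2.ne fun τ => enorm_fourierInv_le τ
    _ = _ := by
        rw [← mul_assoc, ← mul_assoc, show (160 : ℝ≥0∞) = ENNReal.ofReal 160 by simp,
          show (80 : ℝ≥0∞) = ENNReal.ofReal 80 by simp, ← ENNReal.ofReal_mul (by positivity),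
          ← ENNReal.ofReal_mul (by positivity)]
        ring_nf

/-- The matrix `α·ξ/|ξ|`. -/
def alphaHat (ξ : R3) : Matrix (Fin 4) (Fin 4) ℂ :=
  alphaD fun k => inner ℝ (EuclideanSpace.single k 1) ξ / ‖ξ‖

lemma alphaHat_mulVec (ξ : R3) (v : Spinor) :
    (alphaHat ξ).mulVec v = ∑ k, (inner ℝ (EuclideanSpace.single k 1) ξ / ‖ξ‖ : ℝ) •
      (diracAlpha k).mulVec v := by
  simp only [alphaHat, alphaD, Matrix.sum_mulVec, Matrix.smul_mulVec, Complex.coe_smul]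

lemma alphaHat_zero : alphaHat 0 = 0 := by simp [alphaHat, alphaD]

lemma alphaD_mul_self (a : Fin 3 → ℝ) :
    alphaD a * alphaD a = ((∑ k, a k ^ 2 : ℝ) : ℂ) • 1 := by
  ext i j
  fin_cases i <;> fin_cases j <;>
  simp [alphaD, diracAlpha, pauli, Matrix.mul_apply, Fin.sum_univ_succ, finSumFinEquiv,
    Fin.addCases, Matrix.fromBlocks] <;> ring_nf <;> simp

lemma alphaHat_mul_self {ξ : R3} (hξ : ξ ≠ 0) : alphaHat ξ * alphaHat ξ = 1 := by
  have h : ∑ k, (inner ℝ (EuclideanSpace.single k 1) ξ / ‖ξ‖) ^ 2 = (1 : ℝ) := by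
    simp only [div_pow, ← Finset.sum_div, EuclideanSpace.inner_single_left, map_one, one_mul]
    rw [EuclideanSpace.norm_sq_eq]
    simp only [Real.norm_eq_abs, sq_abs]
    refine div_self fun h0 => hξ ?_
    rw [← norm_eq_zero, ← sq_eq_zero_iff, EuclideanSpace.norm_sq_eq]
    simpa only [Real.norm_eq_abs, sq_abs] using h0
  rw [alphaHat, alphaD_mul_self, h, Complex.ofReal_one, one_smul]

lemma alphaHat_mulVec_alphaHat_mulVec {ξ : R3} {v : Spinor} (hv : ξ = 0 → v = 0) :
    (alphaHat ξ).mulVec ((alphaHat ξ).mulVec v) = v := by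
  by_cases hξ : ξ = 0
  · simp [hv hξ]
  · rw [Matrix.mulVec_mulVec, alphaHat_mul_self hξ, Matrix.one_mulVec]

lemma alphaHat_neg (ξ : R3) : alphaHat (-ξ) = -alphaHat ξ := by
  simp [alphaHat, alphaD, inner_neg_right, neg_div, Finset.sum_neg_distrib]

lemma norm_diracAlpha_apply_le (k : Fin 3) (i j : Fin 4) : ‖diracAlpha k i j‖ ≤ 1 := by
  fin_cases k <;> fin_cases i <;> fin_cases j <;>
  simp [diracAlpha, pauli, finSumFinEquiv, Fin.addCases, Matrix.fromBlocks]

lemma norm_diracAlpha_mulVec_le (k : Fin 3) (v : Spinor) :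
    ‖(diracAlpha k).mulVec v‖ ≤ 4 * ‖v‖ := by
  refine (pi_norm_le_iff_of_nonneg (by positivity)).2 fun i => ?_
  rw [Matrix.mulVec, dotProduct]
  refine (norm_sum_le_of_le (f := fun j => diracAlpha k i j * v j) (n := fun _ => ‖v‖) Finset.univ
    fun j _ => ?_).trans_eq (by simp)
  rw [norm_mul]
  exact (mul_le_of_le_one_left (norm_nonneg _) (norm_diracAlpha_apply_le k i j)).trans
    (norm_le_pi_norm v j)

lemma norm_alphaHat_mulVec_le (ξ : R3) (v : Spinor) : ‖(alphaHat ξ).mulVec v‖ ≤ 12 * ‖v‖ := by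
  rw [alphaHat_mulVec]
  refine (norm_sum_le_of_le (n := fun _ => 4 * ‖v‖) Finset.univ fun k _ => ?_).trans_eq
    (by simp; ring)
  rw [norm_smul]
  refine (mul_le_of_le_one_left (norm_nonneg _) ?_).trans (norm_diracAlpha_mulVec_le k v)
  exact (abs_inner_div_norm_le _ ξ).trans_eq (by simp)

lemma integrable_diracAlpha_mulVec {g : R3 → Spinor} (hg : Integrable g) (k : Fin 3) :
    Integrable fun x => (diracAlpha k).mulVec (g x) :=
  (LinearMap.toContinuousLinearMap (Matrix.mulVecLin (diracAlpha k))).integrable_comp hg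

lemma integrable_alphaHat_mulVec {g : R3 → Spinor} (hg : Integrable g) :
    Integrable fun x => (alphaHat x).mulVec (g x) := by
  simp only [alphaHat_mulVec]
  exact integrable_finsetSum _ fun k _ =>
    integrable_inner_div_norm_smul (integrable_diracAlpha_mulVec hg k) _

lemma measurable_alphaHat_mulVec {g : R3 → Spinor} (hg : Measurable g) :
    Measurable fun x => (alphaHat x).mulVec (g x) := by
  simp only [alphaHat_mulVec]
  refine Finset.measurable_sum _ fun k _ => (measurable_inner_div_norm _).smul ?_
  exact (LinearMap.toContinuousLinearMap (Matrix.mulVecLin (diracAlpha k))).measurable.comp hg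

lemma fourierInv_apply_spinor {g : R3 → Spinor} (hg : Integrable g) (x : R3) (j : Fin 4) :
    𝓕⁻ g x j = 𝓕⁻ (fun ξ => g ξ j) x := by
  rw [Real.fourierInv_eq_fourier_neg, Real.fourierInv_eq_fourier_neg, Real.fourier_eq,
    Real.fourier_eq]
  exact eval_integral (fun i => ((Real.fourierIntegral_convergent_iff (-x)).2 hg).eval i) j

lemma diracSymb_mulVec (t : ℝ) (ξ : R3) (v : Spinor) :
    (diracSymb t ξ).mulVec v = (Real.cos (t * ‖ξ‖) : ℂ) • v +
      (Complex.I * (Real.sin (t * ‖ξ‖) : ℂ)) • (alphaHat ξ).mulVec v := by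
  have h : alphaHat ξ = (‖ξ‖ : ℂ)⁻¹ • alphaD fun k => ξ k := by
    simp only [alphaHat, alphaD, Finset.smul_sum, smul_smul, EuclideanSpace.inner_single_left]
    refine Finset.sum_congr rfl fun k _ => ?_
    congr 1
    simp
    ring
  rw [diracSymb, h, Matrix.add_mulVec, Matrix.smul_mulVec, Matrix.smul_mulVec, Matrix.smul_mulVec,
    Matrix.one_mulVec, smul_smul, div_eq_mul_inv]

/-- Projection of the Dirac symbol on the two half-waves. -/
lemma diracSymb_mulVec_eq_halfWaves (t : ℝ) (ξ : R3) (a b : Spinor) (hb : ξ = 0 → b = 0) :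
    (diracSymb t ξ).mulVec (a + (alphaHat ξ).mulVec b) =
      Complex.exp ((1 * t * ‖ξ‖ : ℝ) * Complex.I) • ((1 / 2 : ℝ) • (a + b) +
        (1 : ℝ) • (alphaHat ξ).mulVec ((1 / 2 : ℝ) • (a + b))) +
      Complex.exp ((-1 * t * ‖ξ‖ : ℝ) * Complex.I) • ((1 / 2 : ℝ) • (a - b) +
        (-1 : ℝ) • (alphaHat ξ).mulVec ((1 / 2 : ℝ) • (a - b))) := by
  rw [diracSymb_mulVec, Matrix.mulVec_add, alphaHat_mulVec_alphaHat_mulVec hb, Matrix.mulVec_smul,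
    Matrix.mulVec_smul, Matrix.mulVec_add, Matrix.mulVec_sub]
  have h1 : Complex.exp ((1 * t * ‖ξ‖ : ℝ) * Complex.I) =
      Real.cos (t * ‖ξ‖) + Real.sin (t * ‖ξ‖) * Complex.I := by
    rw [Complex.exp_mul_I, one_mul, Complex.ofReal_cos, Complex.ofReal_sin]
  have h2 : Complex.exp ((-1 * t * ‖ξ‖ : ℝ) * Complex.I) =
      Real.cos (t * ‖ξ‖) - Real.sin (t * ‖ξ‖) * Complex.I := by
    rw [Complex.exp_mul_I, Complex.ofReal_cos, Complex.ofReal_sin, neg_mul, neg_mul, one_mul,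
      Complex.ofReal_neg, Complex.cos_neg, Complex.sin_neg]
    ring
  rw [h1, h2]
  ext i
  simp only [Pi.add_apply, Pi.sub_apply, Pi.smul_apply, smul_eq_mul, Complex.real_smul]
  push_cast
  ring

lemma diracSymb_neg_mulVec_diracSymb_mulVec (t : ℝ) {ξ : R3} (hξ : ξ ≠ 0) (v : Spinor) :
    (diracSymb (-t) ξ).mulVec ((diracSymb t ξ).mulVec v) = v := by
  rw [diracSymb_mulVec, diracSymb_mulVec, Matrix.mulVec_add, Matrix.mulVec_smul,
    Matrix.mulVec_smul, alphaHat_mulVec_alphaHat_mulVec fun h => absurd h hξ, neg_mul, Real.cos_neg,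
    Real.sin_neg]
  have h := Complex.cos_sq_add_sin_sq (t * ‖ξ‖)
  ext i
  simp only [Pi.add_apply, Pi.smul_apply, smul_eq_mul]
  push_cast
  linear_combination v i * h - Complex.sin (t * ‖ξ‖) ^ 2 * v i * Complex.I_sq

lemma integrable_diracSymb_mulVec {g : R3 → Spinor} (hg : Integrable g) (t : ℝ) :
    Integrable fun ξ => (diracSymb t ξ).mulVec (g ξ) := by
  simp only [diracSymb_mulVec]
  have hc : Measurable fun ξ : R3 => (Real.cos (t * ‖ξ‖) : ℂ) := by fun_prop
  have hs : Measurable fun ξ : R3 => Complex.I * (Real.sin (t * ‖ξ‖) : ℂ) := by fun_prop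
  refine (hg.bdd_smul 1 hc.aestronglyMeasurable (ae_of_all _ fun ξ => ?_)).add
    ((integrable_alphaHat_mulVec hg).bdd_smul 1 hs.aestronglyMeasurable (ae_of_all _ fun ξ => ?_))
  · rw [Complex.norm_real]
    exact Real.abs_cos_le_one _
  · rw [norm_mul, Complex.norm_I, one_mul, Complex.norm_real]
    exact Real.abs_sin_le_one _

lemma integrable_diracSymb_mulVec_iff {g : R3 → Spinor} (t : ℝ) :
    Integrable (fun ξ => (diracSymb t ξ).mulVec (g ξ)) ↔ Integrable g := by
  refine ⟨fun h => (integrable_diracSymb_mulVec h (-t)).congr ?_,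
    fun h => integrable_diracSymb_mulVec h t⟩
  filter_upwards [compl_mem_ae_iff.2 (measure_singleton (0 : R3))] with ξ hξ
  exact diracSymb_neg_mulVec_diracSymb_mulVec t hξ _

lemma fourier_clm_comp {E F : Type*} [NormedAddCommGroup E] [NormedSpace ℂ E] [CompleteSpace E]
    [NormedAddCommGroup F] [NormedSpace ℂ F] [CompleteSpace F] (T : E →L[ℂ] F) {g : R3 → E}
    (hg : Integrable g) (ξ : R3) : 𝓕 (fun x => T (g x)) ξ = T (𝓕 g ξ) := by
  rw [Real.fourier_eq, Real.fourier_eq,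
    ← T.integral_comp_comm ((Real.fourierIntegral_convergent_iff ξ).2 hg)]
  simp only [Circle.smul_def, map_smul]

lemma fourier_sum {E ι : Type*} [NormedAddCommGroup E] [NormedSpace ℂ E] (s : Finset ι)
    {g : ι → R3 → E} (hg : ∀ i ∈ s, Integrable (g i)) (ξ : R3) :
    𝓕 (fun x => ∑ i ∈ s, g i x) ξ = ∑ i ∈ s, 𝓕 (g i) ξ := by
  simp only [Real.fourier_eq, Finset.smul_sum]
  exact integral_finsetSum s fun i hi => (Real.fourierIntegral_convergent_iff ξ).2 (hg i hi)

lemma fourierInv_sum {E ι : Type*} [NormedAddCommGroup E] [NormedSpace ℂ E] (s : Finset ι)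
    {g : ι → R3 → E} (hg : ∀ i ∈ s, Integrable (g i)) (x : R3) :
    𝓕⁻ (fun ξ => ∑ i ∈ s, g i ξ) x = ∑ i ∈ s, 𝓕⁻ (g i) x := by
  simp only [Real.fourierInv_eq_fourier_neg]
  exact fourier_sum s hg _

lemma fourierInv_add {E : Type*} [NormedAddCommGroup E] [NormedSpace ℂ E] {g h : R3 → E}
    (hg : Integrable g) (hh : Integrable h) (x : R3) :
    𝓕⁻ (fun ξ => g ξ + h ξ) x = 𝓕⁻ g x + 𝓕⁻ h x := by
  simp only [Real.fourierInv_eq_fourier_neg]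
  exact congrFun (VectorFourier.fourierIntegral_add Real.continuous_fourierChar
    continuous_inner hg hh) (-x)

lemma fourierInv_const_mul (c : ℂ) (g : R3 → ℂ) (x : R3) :
    𝓕⁻ (fun ξ => c * g ξ) x = c * 𝓕⁻ g x := by
  simp only [Real.fourierInv_eq_fourier_neg]
  exact congrFun (VectorFourier.fourierIntegral_const_smul Real.fourierChar volume (innerₗ R3) g c)
    (-x)

lemma integrable_exp_smul {E : Type*} [NormedAddCommGroup E] [NormedSpace ℂ E] {g : R3 → E}
    (hg : Integrable g) (t : ℝ) :
    Integrable fun ξ => Complex.exp ((t * ‖ξ‖ : ℝ) * Complex.I) • g ξ := by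
  have he : Measurable fun ξ : R3 => Complex.exp ((t * ‖ξ‖ : ℝ) * Complex.I) := by fun_prop
  refine hg.bdd_smul 1 he.aestronglyMeasurable (ae_of_all _ fun ξ => ?_)
  rw [Complex.norm_exp_ofReal_mul_I]

lemma integrable_halfWave {h : R3 → Spinor} (hi : Integrable h) (ε t : ℝ) :
    Integrable fun ξ => Complex.exp ((ε * t * ‖ξ‖ : ℝ) * Complex.I) •
      (h ξ + ε • (alphaHat ξ).mulVec (h ξ)) :=
  integrable_exp_smul (hi.add ((integrable_alphaHat_mulVec hi).smul ε)) (ε * t)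

/-- Pointwise control of a half-wave with radial data by one-dimensional maximal functions. -/
lemma enorm_fourierInv_halfWave_le {h : R3 → Spinor} (hm : Measurable h) (hr : IsRadial h)
    (hi : Integrable h) {ε : ℝ} (hε : |ε| = 1) (t : ℝ) {x : R3} (hx : x ≠ 0) :
    ‖𝓕⁻ (fun ξ => Complex.exp ((ε * t * ‖ξ‖ : ℝ) * Complex.I) •
      (h ξ + ε • (alphaHat ξ).mulVec (h ξ))) x‖ₑ ≤
      ENNReal.ofReal (16 * π) * ∑ l, maximalFn
        (fun τ => ‖𝓕⁻ (radialProfile fun ξ => h ξ l) τ‖ₑ) (ε * t / (2 * π)) := by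
  set M : Fin 4 → ℝ≥0∞ := fun l => maximalFn
    (fun τ => ‖𝓕⁻ (radialProfile fun ξ => h ξ l) τ‖ₑ) (ε * t / (2 * π)) with hM
  set q : Fin 4 → R3 → ℂ := fun l ξ => Complex.exp ((ε * t * ‖ξ‖ : ℝ) * Complex.I) * h ξ l with hq
  have hml : ∀ l, Measurable fun ξ => h ξ l := fun l => (measurable_pi_apply l).comp hm
  have hrl : ∀ l, IsRadial fun ξ => h ξ l := fun l x y hxy => congrFun (hr x y hxy) l
  have hil : ∀ l, Integrable fun ξ => h ξ l := fun l => hi.eval l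
  have hqi : ∀ l, Integrable (q l) := fun l => integrable_exp_smul (hil l) (ε * t)
  have hqr : ∀ l, IsRadial (q l) := fun l y z hyz => by simp only [hq, hyz, hrl l y z hyz]
  have hqk : ∀ k l, Integrable fun ξ =>
      (inner ℝ (EuclideanSpace.single k 1 : R3) ξ / ‖ξ‖) • q l ξ :=
    fun k l => integrable_inner_div_norm_smul (hqi l) _
  have h0 : ∀ l, ‖𝓕⁻ (q l) x‖ₑ ≤ ENNReal.ofReal (4 * π) * M l := fun l => by
    simpa only [pow_zero, one_smul] using
      enorm_fourierInv_exp_smul_le (hml l) (hrl l) (hil l) 0 (ε * t) hx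
  have h1 : ∀ k l, ‖𝓕⁻ (fun ξ => (inner ℝ (EuclideanSpace.single k 1) ξ / ‖ξ‖) • q l ξ) x‖ₑ ≤
      ENNReal.ofReal (4 * π) * M l := fun k l => by
    rw [fourierInv_inner_div_norm_smul (hqi l) (hqr l), enorm_smul]
    have hle : ‖inner ℝ (EuclideanSpace.single k 1) x / ‖x‖‖ₑ ≤ 1 := by
      rw [← ofReal_norm, ENNReal.ofReal_le_one]
      exact (abs_inner_div_norm_le _ x).trans_eq (by simp)
    refine (mul_le_of_le_one_left zero_le hle).trans ?_
    simpa only [pow_one] using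
      enorm_fourierInv_exp_smul_le (hml l) (hrl l) (hil l) 1 (ε * t) hx
  have hcoef : ∀ k j l, ‖(ε : ℂ) * diracAlpha k j l‖ₑ ≤ 1 := fun k j l => by
    rw [← ofReal_norm, ENNReal.ofReal_le_one, norm_mul, Complex.norm_real, Real.norm_eq_abs, hε,
      one_mul]
    exact norm_diracAlpha_apply_le k j l
  have hj : ∀ j, ‖𝓕⁻ (fun ξ => Complex.exp ((ε * t * ‖ξ‖ : ℝ) * Complex.I) •
      (h ξ + ε • (alphaHat ξ).mulVec (h ξ))) x j‖ₑ ≤ ENNReal.ofReal (16 * π) * ∑ l, M l := by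
    intro j
    rw [fourierInv_apply_spinor (integrable_halfWave hi ε t)]
    have hexp : (fun ξ => (Complex.exp ((ε * t * ‖ξ‖ : ℝ) * Complex.I) •
        (h ξ + ε • (alphaHat ξ).mulVec (h ξ))) j) = fun ξ => q j ξ + ∑ k, ∑ l,
          (ε * diracAlpha k j l) * ((inner ℝ (EuclideanSpace.single k 1) ξ / ‖ξ‖) • q l ξ) := by
      funext ξ
      simp only [alphaHat_mulVec, hq, Pi.smul_apply, Pi.add_apply, Finset.sum_apply, Matrix.mulVec,
        dotProduct, smul_eq_mul, Complex.real_smul, mul_add, Finset.mul_sum]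
      congr 1
      refine Finset.sum_congr rfl fun k _ => Finset.sum_congr rfl fun l _ => ?_
      ring
    have hs : ∀ k, Integrable fun ξ => ∑ l, (ε * diracAlpha k j l) *
        ((inner ℝ (EuclideanSpace.single k 1 : R3) ξ / ‖ξ‖) • q l ξ) := fun k =>
      integrable_finsetSum _ fun l _ => (hqk k l).const_mul _
    rw [hexp, fourierInv_add (hqi j) (integrable_finsetSum _ fun k _ => hs k),
      fourierInv_sum _ fun k _ => hs k]
    have hk : ∀ k, ‖𝓕⁻ (fun ξ => ∑ l, (ε * diracAlpha k j l) *
        ((inner ℝ (EuclideanSpace.single k 1 : R3) ξ / ‖ξ‖) • q l ξ)) x‖ₑ ≤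
        ENNReal.ofReal (4 * π) * ∑ l, M l := by
      intro k
      rw [fourierInv_sum _ fun l _ => (hqk k l).const_mul _, Finset.mul_sum]
      refine (enorm_sum_le _ _).trans (Finset.sum_le_sum fun l _ => ?_)
      rw [fourierInv_const_mul, enorm_mul]
      exact (mul_le_of_le_one_left zero_le (hcoef k j l)).trans (h1 k l)
    calc _ ≤ ENNReal.ofReal (4 * π) * ∑ l, M l +
          ∑ _k : Fin 3, ENNReal.ofReal (4 * π) * ∑ l, M l := by
          refine (enorm_add_le _ _).trans (add_le_add ((h0 j).trans ?_)
            ((enorm_sum_le _ _).trans (Finset.sum_le_sum fun k _ => hk k)))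
          gcongr
          exact Finset.single_le_sum (f := M) (fun _ _ => zero_le) (Finset.mem_univ j)
      _ = _ := by
          have h16 : ENNReal.ofReal (16 * π) = 4 * ENNReal.ofReal (4 * π) := by
            rw [← ENNReal.ofReal_ofNat 4, ← ENNReal.ofReal_mul (by positivity)]
            ring_nf
          rw [Finset.sum_const, Finset.card_univ, Fintype.card_fin, nsmul_eq_mul, h16]
          push_cast
          ring
  rw [← edist_zero_right]
  refine edist_pi_le_iff.2 fun j => ?_
  rw [Pi.zero_apply, edist_zero_right]
  exact hj j

lemma IsRadial.fderiv_equivariant {E : Type*} [NormedAddCommGroup E] [NormedSpace ℝ E]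
    {f : R3 → E} (hf : IsRadial f) (A : R3 ≃ₗᵢ[ℝ] R3) (x w : R3) :
    fderiv ℝ f (A x) (A w) = fderiv ℝ f x w := by
  have h := A.toContinuousLinearEquiv.comp_right_fderiv (f := f) (x := x)
  have hfA : f ∘ A.toContinuousLinearEquiv = f := funext (hf.comp_linearIsometryEquiv A)
  rw [hfA] at h
  rw [h]
  rfl

lemma sum_diracAlpha_mulVec_equivariant {D : R3 → R3 →ₗ[ℝ] Spinor}
    (hD : ∀ (A : R3 ≃ₗᵢ[ℝ] R3) (x w : R3), D (A x) (A w) = D x w) (x : R3) :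
    ∑ k, (diracAlpha k).mulVec (D x (EuclideanSpace.single k 1)) =
      (alphaHat x).mulVec (D x (‖x‖⁻¹ • x)) := by
  rw [alphaHat_mulVec]
  refine Finset.sum_congr rfl fun k _ => ?_
  rw [equivariant_apply_eq hD x (EuclideanSpace.single k 1), Matrix.mulVec_smul]

lemma continuous_fourier_of_integrable {E : Type*} [NormedAddCommGroup E] [NormedSpace ℂ E] {g : R3 → E}
    (hg : Integrable g) : Continuous (𝓕 g) :=
  VectorFourier.fourierIntegral_continuous Real.continuous_fourierChar continuous_inner hg

/-- The Fourier transform of an element of `𝓗̇¹` is `A + (α·ξ/|ξ|) B` with `A`, `B` radial. -/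
lemma Hclass.exists_radial_fourier {f : R3 → Spinor} (hf : Hclass f) (hi : Integrable f) :
    ∃ A B : R3 → Spinor, Measurable A ∧ Measurable B ∧ IsRadial A ∧ IsRadial B ∧ B 0 = 0 ∧
      (∀ ξ, 𝓕 f ξ = A ξ + (alphaHat ξ).mulVec (B ξ)) ∧
      (∀ ξ, ‖A ξ‖ ≤ 12 * (‖𝓕 f ξ‖ + ‖𝓕 f (-ξ)‖)) ∧
      ∀ ξ, ‖B ξ‖ ≤ 12 * (‖𝓕 f ξ‖ + ‖𝓕 f (-ξ)‖) := by
  obtain ⟨f₁, f₂, h₁, h₂, -, -, hf⟩ := hf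
  have hr₁ : IsRadial f₁ := fun x y hxy => funext fun j => h₁ j x y hxy
  have hr₂ : IsRadial f₂ := fun x y hxy => funext fun j => h₂ j x y hxy
  let D : R3 → R3 →ₗ[ℝ] Spinor := fun x => (fderiv ℝ f₂ x : R3 →ₗ[ℝ] Spinor)
  have hD : ∀ (A : R3 ≃ₗᵢ[ℝ] R3) (x w : R3), D (A x) (A w) = D x w := hr₂.fderiv_equivariant
  have hg : ∀ x, diracOp f₂ x = (-Complex.I) • (alphaHat x).mulVec (D x (‖x‖⁻¹ • x)) := fun x =>
    congrArg ((-Complex.I) • ·) (sum_diracAlpha_mulVec_equivariant hD x)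
  have hgo : ∀ x, diracOp f₂ (-x) = -diracOp f₂ x := fun x => by
    rw [hg, hg, equivariant_apply_radial hD (norm_neg x), alphaHat_neg, Matrix.neg_mulVec, smul_neg]
  have hfx : ∀ x, f x = f₁ x + diracOp f₂ x := fun x => congrFun hf x
  have hi₁ : Integrable f₁ := by
    refine ((hi.add hi.comp_neg).smul (1 / 2 : ℝ)).congr (ae_of_all _ fun x => ?_)
    simp only [Pi.smul_apply, Pi.add_apply, hfx, hgo, hr₁ (-x) x (norm_neg x)]
    module
  have hig : Integrable (diracOp f₂) := by
    refine ((hi.sub hi.comp_neg).smul (1 / 2 : ℝ)).congr (ae_of_all _ fun x => ?_)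
    simp only [Pi.smul_apply, Pi.sub_apply, hfx, hgo, hr₁ (-x) x (norm_neg x)]
    module
  have hid : Integrable fun x => D x (‖x‖⁻¹ • x) := by
    refine ((integrable_alphaHat_mulVec hig).smul Complex.I).congr (ae_of_all _ fun x => ?_)
    simp only [Pi.smul_apply, hg, Matrix.mulVec_smul]
    rw [alphaHat_mulVec_alphaHat_mulVec (by rintro rfl; simp), smul_smul]
    simp
  have hint : ∀ w, Integrable fun x => D x w := fun w => by
    refine (integrable_inner_div_norm_smul hid w).congr (ae_of_all _ fun x => ?_)
    exact (equivariant_apply_eq hD x w).symm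
  let V := fourierLinear D hint
  have hV := fourierLinear_equivariant hint hD
  have hO : ∀ ξ, 𝓕 (diracOp f₂) ξ = (-Complex.I) • (alphaHat ξ).mulVec (V ξ (‖ξ‖⁻¹ • ξ)) := by
    intro ξ
    have h1 : ∀ k, Integrable fun x =>
        (diracAlpha k).mulVec (D x (EuclideanSpace.single k 1)) := fun k =>
      integrable_diracAlpha_mulVec (hint _) k
    have h2 : 𝓕 (diracOp f₂) ξ = (-Complex.I) •
        𝓕 (fun x => ∑ k, (diracAlpha k).mulVec (D x (EuclideanSpace.single k 1))) ξ :=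
      congrFun (VectorFourier.fourierIntegral_const_smul Real.fourierChar volume (innerₗ R3)
        (fun x => ∑ k, (diracAlpha k).mulVec (D x (EuclideanSpace.single k 1))) (-Complex.I)) ξ
    rw [h2, fourier_sum _ fun k _ => h1 k, ← sum_diracAlpha_mulVec_equivariant hV]
    congr 1
    refine Finset.sum_congr rfl fun k _ => ?_
    exact fourier_clm_comp (LinearMap.toContinuousLinearMap (Matrix.mulVecLin (diracAlpha k)))
      (hint (EuclideanSpace.single k 1)) ξ
  have hB : ∀ ξ, (alphaHat ξ).mulVec (𝓕 (diracOp f₂) ξ) =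
      (-Complex.I) • V ξ (‖ξ‖⁻¹ • ξ) := fun ξ => by
    rw [hO, Matrix.mulVec_smul, alphaHat_mulVec_alphaHat_mulVec (by rintro rfl; simp)]
  have hOo : ∀ ξ, 𝓕 (diracOp f₂) (-ξ) = -𝓕 (diracOp f₂) ξ := fun ξ => by
    rw [hO, hO, equivariant_apply_radial hV (norm_neg ξ), alphaHat_neg, Matrix.neg_mulVec, smul_neg]
  have hF : ∀ ξ, 𝓕 f ξ = 𝓕 f₁ ξ + 𝓕 (diracOp f₂) ξ := fun ξ => by
    rw [hf]
    exact congrFun (VectorFourier.fourierIntegral_add Real.continuous_fourierChar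
      continuous_inner hi₁ hig) ξ
  have hF' : ∀ ξ, 𝓕 f (-ξ) = 𝓕 f₁ ξ - 𝓕 (diracOp f₂) ξ := fun ξ => by
    rw [hF, hOo, hr₁.fourier (-ξ) ξ (norm_neg ξ), sub_eq_add_neg]
  have hnorm : ∀ a b : Spinor, ‖a‖ ≤ ‖a + b‖ + ‖a - b‖ ∧ ‖b‖ ≤ ‖a + b‖ + ‖a - b‖ := by
    intro a b
    have ha : a = (1 / 2 : ℝ) • ((a + b) + (a - b)) := by module
    have hb : b = (1 / 2 : ℝ) • ((a + b) - (a - b)) := by module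
    have h0 : 0 ≤ ‖a + b‖ + ‖a - b‖ := by positivity
    constructor
    · calc ‖a‖ = ‖(1 / 2 : ℝ) • ((a + b) + (a - b))‖ := by rw [← ha]
        _ = 1 / 2 * ‖(a + b) + (a - b)‖ := by rw [norm_smul]; norm_num
        _ ≤ 1 / 2 * (‖a + b‖ + ‖a - b‖) := by gcongr; exact norm_add_le _ _
        _ ≤ _ := by linarith
    · calc ‖b‖ = ‖(1 / 2 : ℝ) • ((a + b) - (a - b))‖ := by rw [← hb]
        _ = 1 / 2 * ‖(a + b) - (a - b)‖ := by rw [norm_smul]; norm_num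
        _ ≤ 1 / 2 * (‖a + b‖ + ‖a - b‖) := by gcongr; exact norm_sub_le _ _
        _ ≤ _ := by linarith
  refine ⟨𝓕 f₁, fun ξ => (alphaHat ξ).mulVec (𝓕 (diracOp f₂) ξ),
    (continuous_fourier_of_integrable hi₁).measurable,
    measurable_alphaHat_mulVec (continuous_fourier_of_integrable hig).measurable, hr₁.fourier,
    fun ξ η h => ?_, by simp [alphaHat_zero], fun ξ => ?_, fun ξ => ?_, fun ξ => ?_⟩
  · beta_reduce
    rw [hB, hB, equivariant_apply_radial hV h]
  · rw [hF, alphaHat_mulVec_alphaHat_mulVec]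
    rintro rfl
    rw [hO, alphaHat_zero, Matrix.zero_mulVec, smul_zero]
  · rw [hF', hF]
    have := (hnorm (𝓕 f₁ ξ) (𝓕 (diracOp f₂) ξ)).1
    nlinarith [norm_nonneg (𝓕 f₁ ξ)]
  · rw [hF', hF]
    refine (norm_alphaHat_mulVec_le ξ _).trans ?_
    gcongr
    exact (hnorm (𝓕 f₁ ξ) (𝓕 (diracOp f₂) ξ)).2

lemma ENNReal.sq_sum_le {ι : Type*} (s : Finset ι) (a : ι → ℝ≥0∞) :
    (∑ i ∈ s, a i) ^ 2 ≤ s.card * ∑ i ∈ s, a i ^ 2 := by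
  have h := ENNReal.rpow_sum_le_const_mul_sum_rpow s a (p := 2) one_le_two
  norm_num at h
  exact h

lemma ENNReal.add_sq_le (a b : ℝ≥0∞) : (a + b) ^ 2 ≤ 2 * (a ^ 2 + b ^ 2) := by
  simpa [Fin.sum_univ_two] using ENNReal.sq_sum_le Finset.univ ![a, b]

/-- The sum over components of the maximal functions of the one-dimensional profiles. -/
def profileMaximal (h : R3 → Spinor) (τ : ℝ) : ℝ≥0∞ :=
  ∑ l, maximalFn (fun τ => ‖𝓕⁻ (radialProfile fun ξ => h ξ l) τ‖ₑ) τ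

lemma measurable_profileMaximal {h : R3 → Spinor} (hm : Measurable h) (hr : IsRadial h)
    (hi : Integrable h) : Measurable (profileMaximal h) := by
  refine Finset.measurable_sum _ fun l _ => measurable_maximalFn ?_
  exact (continuous_fourierInv (integrable_radialProfile ((measurable_pi_apply l).comp hm)
    (fun x y hxy => congrFun (hr x y hxy) l) (hi.eval l))).measurable.enorm

lemma lintegral_profileMaximal_sq_le {h : R3 → Spinor} (hm : Measurable h) (hr : IsRadial h)
    (hi : Integrable h) {ε : ℝ} (hε : |ε| = 1) :
    ∫⁻ t : ℝ, profileMaximal h (ε * t / (2 * π)) ^ 2 ≤ 1280 * ∫⁻ ξ, (‖ξ‖ₑ * ‖h ξ‖ₑ) ^ 2 := by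
  have hml : ∀ l, Measurable fun ξ => h ξ l := fun l => (measurable_pi_apply l).comp hm
  have hrl : ∀ l, IsRadial fun ξ => h ξ l := fun l x y hxy => congrFun (hr x y hxy) l
  have hmM : ∀ l, Measurable fun t : ℝ => maximalFn
      (fun τ => ‖𝓕⁻ (radialProfile fun ξ => h ξ l) τ‖ₑ) (ε * t / (2 * π)) ^ 2 := fun l =>
    ((measurable_maximalFn (continuous_fourierInv (integrable_radialProfile (hml l) (hrl l)
      (hi.eval l))).measurable.enorm).comp (by fun_prop)).pow_const 2
  calc _ ≤ ∫⁻ t : ℝ, 4 * ∑ l, maximalFn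
        (fun τ => ‖𝓕⁻ (radialProfile fun ξ => h ξ l) τ‖ₑ) (ε * t / (2 * π)) ^ 2 :=
        lintegral_mono fun t => by
          simpa [profileMaximal] using ENNReal.sq_sum_le Finset.univ fun l =>
            maximalFn (fun τ => ‖𝓕⁻ (radialProfile fun ξ => h ξ l) τ‖ₑ) (ε * t / (2 * π))
    _ = 4 * ∑ l, ∫⁻ t : ℝ, maximalFn
        (fun τ => ‖𝓕⁻ (radialProfile fun ξ => h ξ l) τ‖ₑ) (ε * t / (2 * π)) ^ 2 := by
        rw [lintegral_const_mul' _ _ (by simp), lintegral_finsetSum _ fun l _ => hmM l]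
    _ ≤ 4 * ∑ _l : Fin 4, 80 * ∫⁻ ξ, (‖ξ‖ₑ * ‖h ξ‖ₑ) ^ 2 := by
        gcongr with l
        refine (lintegral_maximalFn_radialProfile_le (hml l) (hrl l) (hi.eval l) hε).trans ?_
        gcongr with ξ
        rw [← ofReal_norm, ← ofReal_norm]
        exact ENNReal.ofReal_le_ofReal (norm_le_pi_norm (h ξ) l)
    _ = _ := by
        rw [Finset.sum_const, Finset.card_univ, Fintype.card_fin, nsmul_eq_mul, ← mul_assoc,
          ← mul_assoc]
        norm_num

lemma hSob_one_sq (f : R3 → Spinor) : hSob 1 f ^ 2 = ∫⁻ ξ, (‖ξ‖ₑ * ‖𝓕 f ξ‖ₑ) ^ 2 := by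
  have h := eLpNorm_nnreal_pow_eq_lintegral (μ := volume)
    (f := fun ξ : R3 => ‖ξ‖ ^ (1 : ℝ) • 𝓕 f ξ) (p := 2) (by simp)
  simp only [NNReal.coe_ofNat, ENNReal.rpow_ofNat, Real.rpow_one, enorm_smul, enorm_norm] at h
  simpa [hSob] using h

lemma lintegral_weighted_sq_le {f h : R3 → Spinor}
    (hh : ∀ ξ, ‖h ξ‖ ≤ 12 * (‖𝓕 f ξ‖ + ‖𝓕 f (-ξ)‖)) (hF : Measurable (𝓕 f)) :
    ∫⁻ ξ, (‖ξ‖ₑ * ‖h ξ‖ₑ) ^ 2 ≤ 576 * hSob 1 f ^ 2 := by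
  have hG : Measurable fun ξ : R3 => (‖ξ‖ₑ * ‖𝓕 f ξ‖ₑ) ^ 2 :=
    (measurable_enorm.mul hF.enorm).pow_const 2
  have hneg : ∫⁻ ξ : R3, (‖ξ‖ₑ * ‖𝓕 f (-ξ)‖ₑ) ^ 2 = ∫⁻ ξ, (‖ξ‖ₑ * ‖𝓕 f ξ‖ₑ) ^ 2 := by
    have := lintegral_neg_eq_self (μ := volume) fun ξ : R3 => (‖ξ‖ₑ * ‖𝓕 f ξ‖ₑ) ^ 2
    simpa only [enorm_neg] using this
  calc _ ≤ ∫⁻ ξ : R3, 288 * ((‖ξ‖ₑ * ‖𝓕 f ξ‖ₑ) ^ 2 + (‖ξ‖ₑ * ‖𝓕 f (-ξ)‖ₑ) ^ 2) := by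
        refine lintegral_mono fun ξ => ?_
        have h1 : ‖h ξ‖ₑ ≤ 12 * (‖𝓕 f ξ‖ₑ + ‖𝓕 f (-ξ)‖ₑ) := by
          simp only [← ofReal_norm]
          rw [← ENNReal.ofReal_add (norm_nonneg _) (norm_nonneg _), ← ENNReal.ofReal_ofNat,
            ← ENNReal.ofReal_mul (by positivity)]
          exact ENNReal.ofReal_le_ofReal (hh ξ)
        calc (‖ξ‖ₑ * ‖h ξ‖ₑ) ^ 2 ≤ (‖ξ‖ₑ * (12 * (‖𝓕 f ξ‖ₑ + ‖𝓕 f (-ξ)‖ₑ))) ^ 2 := by gcongr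
          _ = 144 * (‖ξ‖ₑ * ‖𝓕 f ξ‖ₑ + ‖ξ‖ₑ * ‖𝓕 f (-ξ)‖ₑ) ^ 2 := by ring
          _ ≤ 144 * (2 * ((‖ξ‖ₑ * ‖𝓕 f ξ‖ₑ) ^ 2 + (‖ξ‖ₑ * ‖𝓕 f (-ξ)‖ₑ) ^ 2)) := by
              gcongr
              exact ENNReal.add_sq_le _ _
          _ = _ := by ring
    _ = 288 * (hSob 1 f ^ 2 + hSob 1 f ^ 2) := by
        rw [lintegral_const_mul' _ _ (by simp), lintegral_add_left hG, hneg, hSob_one_sq]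
    _ = _ := by ring

lemma L2Linf_zero : L2Linf (fun _ => 0) = 0 := by simp [L2Linf]

/-- Endpoint Strichartz estimate for the free Dirac flow on `𝓗̇¹`. -/
theorem endpoint_strichartz_free :
    ∃ C : ℝ≥0, ∀ f : R3 → Spinor, Hclass f →
      L2Linf (fun t => diracProp t f) ≤ (C : ℝ≥0∞) * hSob 1 f := by
  set K : ℝ≥0 := Real.toNNReal (16 * π)
  set C : ℝ≥0 := K * 2000 with hC
  refine ⟨C, fun f hf => ?_⟩
  by_cases hi : Integrable f
  swap
  · have h0 : 𝓕 f = 0 := funext fun ξ => by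
      rw [Real.fourier_eq]
      exact integral_undef fun h => hi ((Real.fourierIntegral_convergent_iff ξ).1 h)
    have h1 : (fun t => diracProp t f) = fun _ => 0 := by
      funext t x
      simp [diracProp, h0, Real.fourierInv_eq, Circle.smul_def]
    rw [h1, L2Linf_zero]
    exact zero_le
  by_cases hFi : Integrable (𝓕 f)
  swap
  · have h1 : (fun t => diracProp t f) = fun _ => 0 := by
      funext t x
      rw [diracProp, Real.fourierInv_eq_fourier_neg, Real.fourier_eq]
      exact integral_undef fun h => hFi ((integrable_diracSymb_mulVec_iff t).1
        ((Real.fourierIntegral_convergent_iff (-x)).1 h))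
    rw [h1, L2Linf_zero]
    exact zero_le
  obtain ⟨A, B, hAm, hBm, hAr, hBr, hB0, hF, hA, hB⟩ := hf.exists_radial_fourier hi
  have hFm : Measurable (𝓕 f) := (continuous_fourier_of_integrable hi).measurable
  set P : R3 → Spinor := fun ξ => (1 / 2 : ℝ) • (A ξ + B ξ) with hP
  set Q : R3 → Spinor := fun ξ => (1 / 2 : ℝ) • (A ξ - B ξ) with hQ
  have hPb : ∀ ξ, ‖P ξ‖ ≤ 12 * (‖𝓕 f ξ‖ + ‖𝓕 f (-ξ)‖) := fun ξ => by
    rw [hP, norm_smul]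
    norm_num
    linarith [norm_add_le (A ξ) (B ξ), hA ξ, hB ξ]
  have hQb : ∀ ξ, ‖Q ξ‖ ≤ 12 * (‖𝓕 f ξ‖ + ‖𝓕 f (-ξ)‖) := fun ξ => by
    rw [hQ, norm_smul]
    norm_num
    linarith [norm_sub_le (A ξ) (B ξ), hA ξ, hB ξ]
  have hPm : Measurable P := (hAm.add hBm).const_smul (1 / 2 : ℝ)
  have hQm : Measurable Q := (hAm.sub hBm).const_smul (1 / 2 : ℝ)
  have hPr : IsRadial P := fun x y h => by simp only [hP, hAr x y h, hBr x y h]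
  have hQr : IsRadial Q := fun x y h => by simp only [hQ, hAr x y h, hBr x y h]
  have hdom : Integrable fun ξ => 12 * (‖𝓕 f ξ‖ + ‖𝓕 f (-ξ)‖) :=
    (hFi.norm.add hFi.comp_neg.norm).const_mul 12
  have hPi : Integrable P := hdom.mono' hPm.aestronglyMeasurable (ae_of_all _ hPb)
  have hQi : Integrable Q := hdom.mono' hQm.aestronglyMeasurable (ae_of_all _ hQb)
  have hpt : ∀ t, eLpNorm (diracProp t f) ⊤ volume ≤
      K * (profileMaximal P (1 * t / (2 * π)) + profileMaximal Q (-1 * t / (2 * π))) := by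
    intro t
    rw [eLpNorm_exponent_top]
    refine eLpNormEssSup_le_of_ae_enorm_bound ?_
    filter_upwards [compl_mem_ae_iff.2 (measure_singleton (0 : R3))] with x hx
    rw [diracProp]
    have hsymb : (fun ξ => (diracSymb t ξ).mulVec (𝓕 f ξ)) = fun ξ =>
        Complex.exp ((1 * t * ‖ξ‖ : ℝ) * Complex.I) •
          (P ξ + (1 : ℝ) • (alphaHat ξ).mulVec (P ξ)) +
        Complex.exp ((-1 * t * ‖ξ‖ : ℝ) * Complex.I) •
          (Q ξ + (-1 : ℝ) • (alphaHat ξ).mulVec (Q ξ)) := funext fun ξ => by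
      rw [hF, diracSymb_mulVec_eq_halfWaves]
      rintro rfl
      exact hB0
    rw [hsymb, fourierInv_add (integrable_halfWave hPi 1 t) (integrable_halfWave hQi (-1) t),
      mul_add]
    exact (enorm_add_le _ _).trans (add_le_add
      (enorm_fourierInv_halfWave_le hPm hPr hPi (by simp) t hx)
      (enorm_fourierInv_halfWave_le hQm hQr hQi (by simp) t hx))
  have hint : ∫⁻ t : ℝ, eLpNorm (diracProp t f) ⊤ volume ^ 2 ≤ (C * hSob 1 f) ^ 2 := by
    have hmP : Measurable fun t : ℝ => profileMaximal P (1 * t / (2 * π)) ^ 2 :=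
      ((measurable_profileMaximal hPm hPr hPi).comp (by fun_prop)).pow_const 2
    calc _ ≤ ∫⁻ t : ℝ, (K : ℝ≥0∞) ^ 2 * 2 * (profileMaximal P (1 * t / (2 * π)) ^ 2 +
          profileMaximal Q (-1 * t / (2 * π)) ^ 2) := by
          refine lintegral_mono fun t => (pow_le_pow_left₀ zero_le (hpt t) 2).trans ?_
          rw [mul_pow, mul_assoc]
          gcongr
          exact ENNReal.add_sq_le _ _
      _ = (K : ℝ≥0∞) ^ 2 * 2 * ((∫⁻ t : ℝ, profileMaximal P (1 * t / (2 * π)) ^ 2) +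
          ∫⁻ t : ℝ, profileMaximal Q (-1 * t / (2 * π)) ^ 2) := by
          rw [lintegral_const_mul' _ _ (by finiteness), lintegral_add_left hmP]
      _ ≤ (K : ℝ≥0∞) ^ 2 * 2 * (1280 * (576 * hSob 1 f ^ 2) + 1280 * (576 * hSob 1 f ^ 2)) := by
          gcongr
          · exact (lintegral_profileMaximal_sq_le hPm hPr hPi (by simp)).trans
              (by gcongr; exact lintegral_weighted_sq_le hPb hFm)
          · exact (lintegral_profileMaximal_sq_le hQm hQr hQi (by simp)).trans
              (by gcongr; exact lintegral_weighted_sq_le hQb hFm)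
      _ = 2949120 * ((K : ℝ≥0∞) * hSob 1 f) ^ 2 := by ring
      _ ≤ 4000000 * ((K : ℝ≥0∞) * hSob 1 f) ^ 2 := by gcongr; norm_num
      _ = _ := by
          rw [hC]
          push_cast
          ring
  calc L2Linf (fun t => diracProp t f) ≤ ((C * hSob 1 f) ^ 2) ^ (1 / 2 : ℝ) :=
        ENNReal.rpow_le_rpow hint (by norm_num)
    _ = C * hSob 1 f := by
        rw [← ENNReal.rpow_natCast, ← ENNReal.rpow_mul]
        norm_num
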